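/- arXiv:1202.0677 — 2 statements merged into one kernel-verified Lean document; each statement's English description precedes it below -/
import Mathlib

section
/- Assume Hypothesis (H). Then for all probability measures μ and ν on ℕ* and all t ≥ 0, ‖ℙ_μ(X_t ∈ · | t < T_0) − ℙ_ν(X_t ∈ · | t < T_0)‖_TV ≤ 2(1 − c_1c_2c_3/(2c_4))^⌊t⌋. -/
open MeasureTheory ENNReal Set Filter
open scoped NNReal ENNReal

noncomputable section

/-- A right-continuous, time-homogeneous Markov process on `ℕ` with laws `P x`
(`P x (X 0 = x) = 1`), in which the state `0` is absorbing and absorption is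
almost sure. The (time-homogeneous, countable-state) Markov property is stated
in terms of the shifted path. -/
structure AbsorbedProcess (Ω : Type*) [MeasurableSpace Ω] where
  P : ℕ → Measure Ω
  prob : ∀ x, IsProbabilityMeasure (P x)
  X : ℝ≥0 → Ω → ℕ
  meas : ∀ t, Measurable (X t)
  init : ∀ x, P x {ω | X 0 ω = x} = 1
  rightCont : ∀ x, ∀ᵐ ω ∂ P x, ∀ t : ℝ≥0, ∃ ε : ℝ≥0, 0 < ε ∧
    ∀ s : ℝ≥0, t ≤ s → s < t + ε → X s ω = X t ω
  markov : ∀ (x y : ℕ) (s : ℝ≥0) (B : Set (ℝ≥0 → ℕ)), MeasurableSet B →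
    P x ({ω | X s ω = y} ∩ {ω | (fun u => X (s + u) ω) ∈ B})
      = P x {ω | X s ω = y} * P y {ω | (fun u => X u ω) ∈ B}
  absorbing : ∀ x, ∀ᵐ ω ∂ P x, ∀ s t : ℝ≥0, s ≤ t → X s ω = 0 → X t ω = 0
  absorbSure : ∀ x, P x {ω | ∃ t : ℝ≥0, X t ω = 0} = 1

variable {Ω : Type*} [MeasurableSpace Ω]

/-- The hitting time `T_K = inf {t ≥ 0 : X_t ∈ K}` (equal to `∞` if `K` is never hit). -/
def hitT (M : AbsorbedProcess Ω) (K : Set ℕ) (ω : Ω) : ℝ≥0∞ :=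
  ⨅ t : {t : ℝ≥0 // M.X t ω ∈ K}, (t.1 : ℝ≥0∞)

/-- The survival event `{t < T_0}`. -/
def alive (M : AbsorbedProcess Ω) (t : ℝ≥0) : Set Ω := {ω | (t : ℝ≥0∞) < hitT M {0} ω}

/-- `ℙ_μ = ∑_x μ({x}) ℙ_x`. -/
def Pmu (M : AbsorbedProcess Ω) (μ : Measure ℕ) : Measure Ω := μ.bind M.P

/-- The conditional distribution `ℙ_μ(X_t ∈ · | t < T_0)`, as a measure on `ℕ`. -/
def condDist (M : AbsorbedProcess Ω) (μ : Measure ℕ) (t : ℝ≥0) : Measure ℕ :=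
  (Pmu M μ (alive M t))⁻¹ • ((Pmu M μ).restrict (alive M t)).map (M.X t)

/-- Total variation distance between two measures on `ℕ`:
`‖μ - ν‖_TV = ∑_x |μ({x}) - ν({x})|`. -/
def tvDist (μ ν : Measure ℕ) : ℝ := ∑' x : ℕ, |(μ {x}).toReal - (ν {x}).toReal|

/-- `e^{l·t}` for an extended nonnegative time `t`. -/
def expE (l : ℝ) (t : ℝ≥0∞) : ℝ≥0∞ :=
  if t = ∞ then ∞ else ENNReal.ofReal (Real.exp (l * t.toReal))

/-- Hypothesis (H): there are `K ⊆ ℕ*`, `x₀ ∈ K` and positive constants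
`c₁, c₂, c₃, c₄, λ₀` such that
(1) `ℙ_x(X_1 = x₀ | 1 < T_0) ≥ c₁` for all `x ∈ ℕ*`;
(2) `inf_{x ∈ K} ℙ_x(t < T_0) ≥ c₂ sup_{x ∈ K} ℙ_x(t < T_0)` for all `t ≥ 0`;
(3) `ℙ_{x₀}(X_t ∈ K) ≥ c₃ e^{-λ₀ t}` for all `t ≥ 0`;
(4) `sup_{x ∈ ℕ*} 𝔼_x(e^{λ₀ (T_K ∧ T_0)}) ≤ c₄`. -/
def HypH (M : AbsorbedProcess Ω) (K : Set ℕ) (x0 : ℕ) (c1 c2 c3 c4 l0 : ℝ) : Prop :=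
  0 ∉ K ∧ x0 ∈ K ∧ 0 < c1 ∧ 0 < c2 ∧ 0 < c3 ∧ 0 < c4 ∧ 0 < l0 ∧
  (∀ x : ℕ, x ≠ 0 → ENNReal.ofReal c1 * M.P x (alive M 1)
      ≤ M.P x ({ω | M.X 1 ω = x0} ∩ alive M 1)) ∧
  (∀ t : ℝ≥0, ∀ x ∈ K, ∀ y ∈ K,
      ENNReal.ofReal c2 * M.P y (alive M t) ≤ M.P x (alive M t)) ∧
  (∀ t : ℝ≥0, ENNReal.ofReal (c3 * Real.exp (-(l0 * (t : ℝ)))) ≤ M.P x0 {ω | M.X t ω ∈ K}) ∧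
  (∀ x : ℕ, x ≠ 0 →
      ∫⁻ ω, expE l0 (min (hitT M K ω) (hitT M {0} ω)) ∂ M.P x ≤ ENNReal.ofReal c4)

namespace AbsorbedProcess

open ProbabilityTheory Topology

/-- The laws `(ℙ_x)` of an absorbed process, as a Markov kernel. -/
def kernel (M : AbsorbedProcess Ω) : Kernel ℕ Ω := ⟨M.P, measurable_of_countable _⟩

/-- The transition kernel `x ↦ ℙ_x(X_t ∈ ·)`. -/
def law (M : AbsorbedProcess Ω) (t : ℝ≥0) : Kernel ℕ ℕ := M.kernel.map (M.X t)

instance (M : AbsorbedProcess Ω) (x : ℕ) : IsProbabilityMeasure (M.P x) := M.prob x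

instance (M : AbsorbedProcess Ω) : IsMarkovKernel M.kernel := ⟨M.prob⟩

instance (M : AbsorbedProcess Ω) (t : ℝ≥0) : IsMarkovKernel (M.law t) :=
  Kernel.IsMarkovKernel.map _ (M.meas t)

lemma law_apply (M : AbsorbedProcess Ω) (t : ℝ≥0) (x : ℕ) :
    M.law t x = (M.P x).map (M.X t) :=
  Kernel.map_apply _ (M.meas t) _

lemma law_apply_set (M : AbsorbedProcess Ω) (t : ℝ≥0) (x : ℕ) (s : Set ℕ) :
    M.law t x s = M.P x {ω | M.X t ω ∈ s} := by
  rw [law_apply, Measure.map_apply (M.meas t) (MeasurableSet.of_discrete)]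
  rfl

/-- Markov property at a deterministic time, for nonnegative functionals of the path. -/
lemma lintegral_shift (M : AbsorbedProcess Ω) (x : ℕ) (s : ℝ≥0) {Φ : (ℝ≥0 → ℕ) → ℝ≥0∞}
    (hΦ : Measurable Φ) :
    ∫⁻ ω, Φ (fun u => M.X (s + u) ω) ∂M.P x
      = ∫⁻ y, ∫⁻ ω, Φ (fun u => M.X u ω) ∂M.P y ∂M.law s x := by
  have hsh : Measurable fun (ω : Ω) (u : ℝ≥0) => M.X (s + u) ω :=
    measurable_pi_lambda _ fun u => M.meas _
  have h0 : Measurable fun (ω : Ω) (u : ℝ≥0) => M.X u ω :=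
    measurable_pi_lambda _ fun u => M.meas _
  have key : (M.P x).map (fun ω u => M.X (s + u) ω)
      = (M.law s x).bind (fun y => (M.P y).map (fun ω u => M.X u ω)) := by
    ext B hB
    rw [Measure.bind_apply hB (measurable_of_countable _).aemeasurable, lintegral_countable',
      Measure.map_apply hsh hB]
    have hU : (fun ω u => M.X (s + u) ω) ⁻¹' B
        = ⋃ y, {ω | M.X s ω = y} ∩ {ω | (fun u => M.X (s + u) ω) ∈ B} := by
      ext ω
      simp
    have hd : Pairwise (Function.onFun Disjoint fun y =>
        {ω | M.X s ω = y} ∩ {ω | (fun u => M.X (s + u) ω) ∈ B}) :=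
      fun y z hyz => Set.disjoint_left.2 fun ω h h' => hyz (h.1.symm.trans h'.1)
    rw [hU, measure_iUnion hd
      fun y => (M.meas s (measurableSet_singleton y)).inter (hsh hB)]
    refine tsum_congr fun y => ?_
    rw [Measure.map_apply h0 hB, law_apply_set, mul_comm]
    exact M.markov x y s B hB
  rw [← lintegral_map hΦ hsh, key,
    Measure.lintegral_bind (measurable_of_countable _).aemeasurable hΦ.aemeasurable]
  exact lintegral_congr fun y => lintegral_map hΦ h0

/-- The Chapman-Kolmogorov equation. -/
lemma law_add (M : AbsorbedProcess Ω) (s t : ℝ≥0) : M.law (s + t) = M.law t ∘ₖ M.law s := by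
  ext x B hB
  rw [Kernel.comp_apply' _ _ _ hB, law_apply_set]
  have h := M.lintegral_shift x s (Φ := fun w => B.indicator 1 (w t))
    ((measurable_of_countable (B.indicator 1)).comp (measurable_pi_apply t))
  have hind (u : ℝ≥0) (y : ℕ) :
      ∫⁻ ω, B.indicator (1 : ℕ → ℝ≥0∞) (M.X u ω) ∂M.P y = M.P y {ω | M.X u ω ∈ B} :=
    lintegral_indicator_one (M.meas u MeasurableSet.of_discrete)
  simp only [hind] at h
  simpa only [law_apply_set] using h

/-- A state is almost surely its own starting point. -/
lemma ae_init (M : AbsorbedProcess Ω) (x : ℕ) : ∀ᵐ ω ∂M.P x, M.X 0 ω = x :=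
  (prob_compl_eq_zero_iff (M.meas 0 (measurableSet_singleton x))).2 (M.init x)

/-- The survival event coincides almost surely with `{X_t ≠ 0}`. -/
lemma ae_mem_alive_iff (M : AbsorbedProcess Ω) (x : ℕ) (t : ℝ≥0) :
    ∀ᵐ ω ∂M.P x, ω ∈ alive M t ↔ M.X t ω ≠ 0 := by
  filter_upwards [M.absorbing x, M.rightCont x] with ω habs hrc
  constructor
  · intro h h0
    have hle : hitT M {0} ω ≤ t :=
      iInf_le (fun u : {u : ℝ≥0 // M.X u ω ∈ ({0} : Set ℕ)} => (u.1 : ℝ≥0∞)) ⟨t, h0⟩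
    exact hle.not_gt h
  · intro h
    obtain ⟨ε, hε, hc⟩ := hrc t
    refine lt_of_lt_of_le (b := ((t + ε : ℝ≥0) : ℝ≥0∞)) ?_ (le_iInf fun u => ?_)
    · exact_mod_cast lt_add_of_pos_right t hε
    · by_contra hlt
      have hlt : u.1 < t + ε := by exact_mod_cast not_le.1 hlt
      rcases le_total u.1 t with hu | hu
      · exact h (habs _ _ hu u.2)
      · exact h ((hc _ hu hlt).symm.trans u.2)

lemma measure_alive (M : AbsorbedProcess Ω) (x : ℕ) (t : ℝ≥0) :
    M.P x (alive M t) = M.law t x {0}ᶜ := by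
  rw [law_apply_set]
  refine measure_congr ?_
  filter_upwards [M.ae_mem_alive_iff x t] with ω h
  exact propext h

lemma law_zero_apply (M : AbsorbedProcess Ω) (t : ℝ≥0) : M.law t 0 {0}ᶜ = 0 := by
  rw [law_apply_set]
  refine measure_eq_zero_iff_ae_notMem.2 ?_
  filter_upwards [M.absorbing 0, M.ae_init 0] with ω habs h0
  simpa using habs 0 t zero_le h0

lemma tendsto_div_add_one (t : ℝ≥0) : Tendsto (fun n : ℕ => t / ((n : ℝ≥0) + 1)) atTop (𝓝 0) := by
  have := (tendsto_one_div_add_atTop_nhds_zero_nat (𝕜 := ℝ≥0)).const_mul t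
  simpa [div_eq_mul_inv] using this

/-- Every non-absorbed state survives up to any given time with positive probability. -/
lemma law_compl_pos (M : AbsorbedProcess Ω) {x : ℕ} (hx : x ≠ 0) (t : ℝ≥0) :
    0 < M.law t x {0}ᶜ := by
  obtain ⟨n, hn⟩ : ∃ n : ℕ, 0 < M.law (t / (n + 1)) x {x} := by
    by_contra! hall
    have h0 : ∀ᵐ ω ∂M.P x, ∀ n : ℕ, M.X (t / (n + 1)) ω ≠ x := by
      refine ae_all_iff.2 fun n => ?_
      have := le_antisymm (hall n) zero_le
      rw [law_apply_set] at this
      exact measure_eq_zero_iff_ae_notMem.1 this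
    obtain ⟨ω, h1, h2, h3⟩ := (h0.and ((M.ae_init x).and (M.rightCont x))).exists
    obtain ⟨ε, hε, hc⟩ := h3 0
    obtain ⟨n, hn⟩ := ((tendsto_div_add_one t).eventually (gt_mem_nhds hε)).exists
    exact h1 n ((hc _ zero_le (by simpa using hn)).trans h2)
  have hpow (k : ℕ) : 0 < M.law (k * (t / (n + 1))) x {x} := by
    induction k with
    | zero => simpa [law_apply_set] using (M.init x).symm ▸ zero_lt_one
    | succ k ih =>
      rw [Nat.cast_succ, add_mul, one_mul, law_add,
        Kernel.comp_apply' _ _ _ (measurableSet_singleton x), lintegral_countable']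
      exact (ENNReal.mul_pos hn.ne' ih.ne').trans_le (ENNReal.le_tsum x)
  have := hpow (n + 1)
  rw [Nat.cast_succ, mul_div_cancel₀ _ (by positivity)] at this
  exact this.trans_le (measure_mono (by simpa using hx.symm))

/-- The functional `e^{l σ}` of a path `w`, where `σ` is the first time of the grid
`0, δ, …, j δ` at which `w` is in `A` (and `σ = j δ` if there is none before). -/
def gridExp (A : Set ℕ) (l : ℝ) (δ : ℝ≥0) : ℕ → (ℝ≥0 → ℕ) → ℝ≥0∞
  | 0, _ => 1
  | j + 1, w => open Classical in
      if w 0 ∈ A then 1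
      else ENNReal.ofReal (Real.exp (l * δ)) * gridExp A l δ j (fun u => w (δ + u))

lemma measurable_gridExp (A : Set ℕ) (l : ℝ) (δ : ℝ≥0) (j : ℕ) :
    Measurable (gridExp A l δ j) := by
  induction j with
  | zero => exact measurable_const
  | succ j ih =>
    refine Measurable.ite (measurable_pi_apply 0 MeasurableSet.of_discrete) measurable_const
      ((ih.comp (measurable_pi_lambda _ fun u => measurable_pi_apply _)).const_mul _)

lemma ofReal_exp_mul_succ (l : ℝ) (δ : ℝ≥0) (i : ℕ) :
    ENNReal.ofReal (Real.exp (l * ((i + 1 : ℕ) * δ : ℝ≥0)))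
      = ENNReal.ofReal (Real.exp (l * δ)) * ENNReal.ofReal (Real.exp (l * (i * δ : ℝ≥0))) := by
  rw [← ENNReal.ofReal_mul (Real.exp_nonneg _), ← Real.exp_add]
  push_cast
  ring_nf

lemma one_le_ofReal_exp {l : ℝ} (hl : 0 ≤ l) (s : ℝ≥0) :
    1 ≤ ENNReal.ofReal (Real.exp (l * s)) := by
  rw [ENNReal.one_le_ofReal]
  exact Real.one_le_exp (by positivity)

lemma gridExp_le_of_mem {A : Set ℕ} {l : ℝ} (hl : 0 ≤ l) {δ : ℝ≥0} {i j : ℕ} {w : ℝ≥0 → ℕ}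
    (hw : w (i * δ) ∈ A) : gridExp A l δ j w ≤ ENNReal.ofReal (Real.exp (l * (i * δ : ℝ≥0))) := by
  induction j generalizing i w with
  | zero => exact one_le_ofReal_exp hl _
  | succ j ih =>
    rw [gridExp]
    split_ifs with h
    · exact one_le_ofReal_exp hl _
    · cases i with
      | zero => exact absurd (by simpa using hw) h
      | succ i =>
        rw [ofReal_exp_mul_succ]
        gcongr
        refine ih ?_
        convert hw using 2
        push_cast
        ring

lemma gridExp_le {A : Set ℕ} {l : ℝ} (hl : 0 ≤ l) (δ : ℝ≥0) (j : ℕ) (w : ℝ≥0 → ℕ) :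
    gridExp A l δ j w ≤ ENNReal.ofReal (Real.exp (l * (j * δ : ℝ≥0))) := by
  induction j generalizing w with
  | zero => exact one_le_ofReal_exp hl _
  | succ j ih =>
    rw [gridExp]
    split_ifs
    · exact one_le_ofReal_exp hl _
    · rw [ofReal_exp_mul_succ]
      gcongr
      exact ih _

/-- Survival is controlled by the exponential moment of the entrance time in `insert 0 K` along a
grid, as soon as it is controlled on `K`. -/
lemma law_compl_le_lintegral_gridExp (M : AbsorbedProcess Ω) {K : Set ℕ} {l : ℝ} {t : ℝ≥0}
    {C : ℝ≥0∞}
    (hK : ∀ s u : ℝ≥0, s + u = t → ∀ y ∈ K,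
      M.law u y {0}ᶜ ≤ C * ENNReal.ofReal (Real.exp (l * s)))
    (h1 : 1 ≤ C * ENNReal.ofReal (Real.exp (l * t)))
    (δ : ℝ≥0) (j : ℕ) (s : ℝ≥0) (hs : s + j * δ = t) (x : ℕ) :
    M.law (j * δ) x {0}ᶜ ≤ C * ENNReal.ofReal (Real.exp (l * s))
      * ∫⁻ ω, gridExp (insert 0 K) l δ j (fun u => M.X u ω) ∂M.P x := by
  induction j generalizing s x with
  | zero =>
    obtain rfl : s = t := by simpa using hs
    simpa [gridExp] using prob_le_one.trans h1
  | succ j ih =>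
    by_cases hx : x ∈ insert 0 K
    · have hF : ∫⁻ ω, gridExp (insert 0 K) l δ (j + 1) (fun u => M.X u ω) ∂M.P x = 1 := by
        rw [lintegral_congr_ae (g := fun _ => 1)]
        · simp
        · filter_upwards [M.ae_init x] with ω h
          rw [gridExp, if_pos (by simpa only [h] using hx)]
      rw [hF, mul_one]
      rcases hx with rfl | hx
      · simp [law_zero_apply]
      · exact hK _ _ hs _ hx
    · have hF : ∫⁻ ω, gridExp (insert 0 K) l δ (j + 1) (fun u => M.X u ω) ∂M.P x
          = ENNReal.ofReal (Real.exp (l * δ))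
            * ∫⁻ y, ∫⁻ ω, gridExp (insert 0 K) l δ j (fun u => M.X u ω) ∂M.P y ∂M.law δ x := by
        rw [← M.lintegral_shift x δ (measurable_gridExp _ l δ j),
          ← lintegral_const_mul (f := fun ω => gridExp (insert 0 K) l δ j fun u => M.X (δ + u) ω) _
            ((measurable_gridExp _ l δ j).comp (measurable_pi_lambda _ fun u => M.meas _))]
        refine lintegral_congr_ae ?_
        filter_upwards [M.ae_init x] with ω h
        rw [gridExp, if_neg (by simpa only [h] using hx)]
      have hexp : ENNReal.ofReal (Real.exp (l * s)) * ENNReal.ofReal (Real.exp (l * δ))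
          = ENNReal.ofReal (Real.exp (l * (s + δ : ℝ≥0))) := by
        rw [← ENNReal.ofReal_mul (Real.exp_nonneg _), ← Real.exp_add, NNReal.coe_add, mul_add]
      rw [hF, ← mul_assoc, mul_assoc C, hexp, ← lintegral_const_mul _ (measurable_of_countable _),
        show ((j + 1 : ℕ) : ℝ≥0) * δ = δ + j * δ by push_cast; ring, law_add,
        Kernel.comp_apply' _ _ _ MeasurableSet.of_discrete]
      exact lintegral_mono fun y => ih (s + δ) (by rw [← hs]; push_cast; ring) y

lemma le_expE_iInf {ι : Type*} {l : ℝ} (hl : 0 < l) {a : ι → ℝ≥0} {G : ℝ≥0∞}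
    (h : ∀ i, G ≤ ENNReal.ofReal (Real.exp (l * a i))) :
    G ≤ expE l (⨅ i, (a i : ℝ≥0∞)) := by
  rw [expE]
  split_ifs with htop
  · exact le_top
  · set r := ⨅ i, (a i : ℝ≥0∞) with hr
    have hlim : Tendsto (fun ε : ℝ => ENNReal.ofReal (Real.exp (l * (r.toReal + ε)))) (𝓝[>] 0)
        (𝓝 (ENNReal.ofReal (Real.exp (l * r.toReal)))) := by
      have hc : Continuous fun ε : ℝ => ENNReal.ofReal (Real.exp (l * (r.toReal + ε))) :=
        ENNReal.continuous_ofReal.comp (by fun_prop)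
      simpa using (hc.tendsto 0).mono_left nhdsWithin_le_nhds
    refine ge_of_tendsto hlim ?_
    filter_upwards [self_mem_nhdsWithin] with ε (hε : 0 < ε)
    have hlt : r < r + ENNReal.ofReal ε :=
      ENNReal.lt_add_right htop (by simpa using hε)
    obtain ⟨i, hi⟩ := iInf_lt_iff.1 (hr ▸ hlt)
    refine (h i).trans ?_
    have := ENNReal.toReal_mono (by finiteness) hi.le
    rw [ENNReal.toReal_add htop (by finiteness), ENNReal.toReal_ofReal hε.le] at this
    gcongr
    simpa using this

/-- Refining the grid on `[0, t]`, the grid entrance times do not exceed the entrance time in the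
limit, along right-continuous paths. -/
lemma limsup_gridExp_le {A : Set ℕ} {l : ℝ} (hl : 0 ≤ l) {t s : ℝ≥0} {w : ℝ≥0 → ℕ} (hs : w s ∈ A)
    (hw : ∃ ε : ℝ≥0, 0 < ε ∧ ∀ u : ℝ≥0, s ≤ u → u < s + ε → w u = w s) :
    limsup (fun n : ℕ => gridExp A l (t / (n + 1)) (n + 1) w) atTop
      ≤ ENNReal.ofReal (Real.exp (l * s)) := by
  rcases le_or_gt t s with hts | hts
  · refine limsup_le_of_le (h := Eventually.of_forall fun n => ?_)
    refine (gridExp_le hl _ _ _).trans ?_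
    rw [Nat.cast_succ, mul_div_cancel₀ _ (by positivity)]
    gcongr
  · obtain ⟨ε, hε, hc⟩ := hw
    have ht : 0 < t := zero_le.trans_lt hts
    have hlim := tendsto_div_add_one t
    have hlim' : Tendsto (fun n : ℕ => ENNReal.ofReal
        (Real.exp (l * (s + t / ((n : ℝ≥0) + 1) : ℝ≥0)))) atTop
        (𝓝 (ENNReal.ofReal (Real.exp (l * s)))) := by
      have hcont : Continuous fun δ : ℝ≥0 => ENNReal.ofReal (Real.exp (l * (s + δ : ℝ≥0))) :=
        ENNReal.continuous_ofReal.comp (by fun_prop)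
      simpa [Function.comp_def] using (hcont.tendsto 0).comp hlim
    rw [← hlim'.limsup_eq]
    refine limsup_le_limsup ?_
    filter_upwards [hlim.eventually (gt_mem_nhds hε)] with n hn
    have hδ : 0 < t / ((n : ℝ≥0) + 1) := by positivity
    set δ := t / ((n : ℝ≥0) + 1)
    have hle : s ≤ ⌈s / δ⌉₊ * δ := (div_le_iff₀ hδ).1 (Nat.le_ceil _)
    have hlt : ⌈s / δ⌉₊ * δ ≤ s + δ := by
      have := (Nat.ceil_lt_add_one (zero_le (a := s / δ))).le
      calc _ ≤ (s / δ + 1) * δ := by gcongr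
        _ = s + δ := by rw [add_mul, div_mul_cancel₀ _ hδ.ne', one_mul]
    refine (gridExp_le_of_mem hl (i := ⌈s / δ⌉₊) ?_).trans ?_
    · rw [hc _ hle (hlt.trans_lt (by gcongr))]
      exact hs
    · gcongr

/-- If survival is controlled on `K`, then it is controlled everywhere by the exponential moment of
the entrance time in `K ∪ {0}`. -/
lemma law_compl_le_lintegral_expE (M : AbsorbedProcess Ω) {K : Set ℕ} {l : ℝ} (hl : 0 < l)
    {t : ℝ≥0} {C : ℝ≥0∞} (hC : C ≠ ∞)
    (hK : ∀ s u : ℝ≥0, s + u = t → ∀ y ∈ K,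
      M.law u y {0}ᶜ ≤ C * ENNReal.ofReal (Real.exp (l * s)))
    (h1 : 1 ≤ C * ENNReal.ofReal (Real.exp (l * t))) (x : ℕ) :
    M.law t x {0}ᶜ ≤ C * ∫⁻ ω, expE l (min (hitT M K ω) (hitT M {0} ω)) ∂M.P x := by
  set I : ℕ → ℝ≥0∞ := fun n =>
    ∫⁻ ω, gridExp (insert 0 K) l (t / (n + 1)) (n + 1) (fun u => M.X u ω) ∂M.P x with hI
  have hbound (n : ℕ) : M.law t x {0}ᶜ ≤ C * I n := by
    have ht : ((n + 1 : ℕ) : ℝ≥0) * (t / (n + 1)) = t := by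
      rw [Nat.cast_succ, mul_div_cancel₀ _ (by positivity)]
    have := M.law_compl_le_lintegral_gridExp hK h1 (t / (n + 1)) (n + 1) 0 (by rw [ht, zero_add]) x
    rw [ht] at this
    simpa using this
  have hlimsup : limsup I atTop
      ≤ ∫⁻ ω, expE l (min (hitT M K ω) (hitT M {0} ω)) ∂M.P x := by
    refine (limsup_lintegral_le (fun _ => ENNReal.ofReal (Real.exp (l * t)))
      (fun n => (measurable_gridExp _ _ _ _).comp (measurable_pi_lambda _ fun u => M.meas _))
      (fun n => Eventually.of_forall fun ω => ?_) (by simp)).trans (lintegral_mono_ae ?_)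
    · refine (gridExp_le hl.le _ _ _).trans_eq ?_
      rw [Nat.cast_succ, mul_div_cancel₀ _ (by positivity)]
    · filter_upwards [M.rightCont x] with ω hrc
      rcases min_choice (hitT M K ω) (hitT M {0} ω) with h | h <;> rw [h] <;>
        refine le_expE_iInf hl fun u => limsup_gridExp_le hl.le ?_ (hrc u.1)
      · exact Or.inr u.2
      · exact Or.inl u.2
  refine le_trans ?_ (mul_le_mul_right hlimsup C)
  rw [← ENNReal.limsup_const_mul_of_ne_top hC]
  exact le_limsup_of_frequently_le (Eventually.of_forall hbound).frequently

/-- Under Hypothesis (H), the survival probability from `x₀` is comparable to the largest one. -/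
lemma law_compl_le_of_hypH (M : AbsorbedProcess Ω) {K : Set ℕ} {x0 : ℕ} {c1 c2 c3 c4 l0 : ℝ}
    (hH : HypH M K x0 c1 c2 c3 c4 l0) (t : ℝ≥0) (x : ℕ) :
    M.law t x {0}ᶜ ≤ ENNReal.ofReal (c4 / (c2 * c3)) * M.law t x0 {0}ᶜ := by
  obtain ⟨h0K, hx0, hc1, hc2, hc3, hc4, hl0, -, H2, H3, H4⟩ := hH
  simp only [measure_alive] at H2
  have hc23 : ENNReal.ofReal (c2 * c3)⁻¹ * ENNReal.ofReal (c2 * c3) = 1 := by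
    rw [← ENNReal.ofReal_mul (by positivity), inv_mul_cancel₀ (by positivity), ENNReal.ofReal_one]
  have hK (s u : ℝ≥0) (hsu : s + u = t) (y : ℕ) (hy : y ∈ K) :
      M.law u y {0}ᶜ ≤ ENNReal.ofReal (c2 * c3)⁻¹ * M.law t x0 {0}ᶜ
        * ENNReal.ofReal (Real.exp (l0 * s)) := by
    have hstep : ENNReal.ofReal c2 * M.law u y {0}ᶜ
        * ENNReal.ofReal (c3 * Real.exp (-(l0 * s))) ≤ M.law t x0 {0}ᶜ := by
      rw [← hsu, law_add, Kernel.comp_apply' _ _ _ MeasurableSet.of_discrete]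
      calc _ ≤ ENNReal.ofReal c2 * M.law u y {0}ᶜ * M.law s x0 K := by
            gcongr
            rw [law_apply_set]
            exact H3 s
        _ = ∫⁻ _ in K, ENNReal.ofReal c2 * M.law u y {0}ᶜ ∂M.law s x0 :=
            (setLIntegral_const _ _).symm
        _ ≤ ∫⁻ z in K, M.law u z {0}ᶜ ∂M.law s x0 :=
            setLIntegral_mono' MeasurableSet.of_discrete fun z hz => H2 u z hz y hy
        _ ≤ _ := setLIntegral_le_lintegral _ _
    have hexp : ENNReal.ofReal c2 * ENNReal.ofReal (c3 * Real.exp (-(l0 * s)))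
        * ENNReal.ofReal (Real.exp (l0 * s)) = ENNReal.ofReal (c2 * c3) := by
      rw [← ENNReal.ofReal_mul hc2.le, ← ENNReal.ofReal_mul (by positivity), mul_assoc, mul_assoc,
        ← Real.exp_add, neg_add_cancel, Real.exp_zero, mul_one]
    calc M.law u y {0}ᶜ
        = ENNReal.ofReal (c2 * c3)⁻¹ * (ENNReal.ofReal c2 * M.law u y {0}ᶜ
          * ENNReal.ofReal (c3 * Real.exp (-(l0 * s)))) * ENNReal.ofReal (Real.exp (l0 * s)) := by
          conv_lhs => rw [← one_mul (M.law u y {0}ᶜ), ← hc23, ← hexp]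
          ring
      _ ≤ _ := by gcongr
  rcases eq_or_ne x 0 with rfl | hx
  · simp [law_zero_apply]
  have h1 : 1 ≤ ENNReal.ofReal (c2 * c3)⁻¹ * M.law t x0 {0}ᶜ
      * ENNReal.ofReal (Real.exp (l0 * t)) := by
    refine le_trans ?_ (hK t 0 (add_zero t) x0 hx0)
    rw [law_apply_set, ← M.init x0]
    refine measure_mono fun ω (h : M.X 0 ω = x0) => ?_
    rintro (h' : M.X 0 ω = 0)
    exact h0K (h' ▸ h ▸ hx0)
  calc M.law t x {0}ᶜ
      ≤ ENNReal.ofReal (c2 * c3)⁻¹ * M.law t x0 {0}ᶜ * ENNReal.ofReal c4 :=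
        (M.law_compl_le_lintegral_expE hl0 (by finiteness) hK h1 x).trans
          (by gcongr; exact H4 x hx)
    _ = _ := by
        rw [mul_right_comm, ← ENNReal.ofReal_mul (by positivity), div_eq_inv_mul]

/-- The survival probability `ℙ_x(t < T_0)`. -/
def surv (M : AbsorbedProcess Ω) (t : ℝ≥0) (x : ℕ) : ℝ := (M.law t x).real {0}ᶜ

lemma surv_pos (M : AbsorbedProcess Ω) {x : ℕ} (hx : x ≠ 0) (t : ℝ≥0) : 0 < M.surv t x :=
  ENNReal.toReal_pos (M.law_compl_pos hx t).ne' (measure_ne_top _ _)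

lemma surv_zero_right (M : AbsorbedProcess Ω) (t : ℝ≥0) : M.surv t 0 = 0 := by
  simp [surv, measureReal_def, law_zero_apply]

lemma surv_nonneg (M : AbsorbedProcess Ω) (t : ℝ≥0) (x : ℕ) : 0 ≤ M.surv t x := measureReal_nonneg

lemma abs_surv_le (M : AbsorbedProcess Ω) (t : ℝ≥0) (x : ℕ) : |M.surv t x| ≤ 1 := by
  rw [abs_of_nonneg (M.surv_nonneg t x)]
  exact measureReal_le_one

lemma integrable_of_abs_le {ν : Measure ℕ} [IsFiniteMeasure ν] {f : ℕ → ℝ} {C : ℝ}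
    (hf : ∀ x, |f x| ≤ C) : Integrable f ν :=
  .of_bound (measurable_of_countable f).aestronglyMeasurable C (ae_of_all _ hf)

lemma abs_integral_le_of_abs_le {ν : Measure ℕ} [IsProbabilityMeasure ν] {f : ℕ → ℝ} {C : ℝ}
    (hf : ∀ x, |f x| ≤ C) : |∫ x, f x ∂ν| ≤ C := by
  simpa using norm_integral_le_of_norm_le_const (μ := ν) (f := f) (ae_of_all _ hf)

lemma integral_law_add (M : AbsorbedProcess Ω) (s t : ℝ≥0) (x : ℕ) {f : ℕ → ℝ} {C : ℝ}
    (hf : ∀ x, |f x| ≤ C) :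
    ∫ z, f z ∂M.law (s + t) x = ∫ y, ∫ z, f z ∂M.law t y ∂M.law s x := by
  rw [law_add, Kernel.integral_comp (integrable_of_abs_le hf)]

lemma surv_eq_integral (M : AbsorbedProcess Ω) (t : ℝ≥0) (x : ℕ) :
    M.surv t x = ∫ y, ({0}ᶜ : Set ℕ).indicator 1 y ∂M.law t x :=
  (integral_indicator_one MeasurableSet.of_discrete).symm

lemma surv_add (M : AbsorbedProcess Ω) (s t : ℝ≥0) (x : ℕ) :
    M.surv (s + t) x = ∫ y, M.surv t y ∂M.law s x := by
  simp only [surv_eq_integral]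
  refine M.integral_law_add s t x (C := 1) fun y => ?_
  by_cases hy : y = 0 <;> simp [hy]

lemma real_singleton_mul_le_integral {ν : Measure ℕ} {f : ℕ → ℝ} (hf : Integrable f ν)
    (h0 : ∀ x, 0 ≤ f x) (a : ℕ) : ν.real {a} * f a ≤ ∫ x, f x ∂ν := by
  have := setIntegral_le_integral (s := {a}) hf (ae_of_all _ h0)
  rwa [integral_singleton, smul_eq_mul] at this

/-- Contraction of the oscillation of `f` under the conditional evolution, under a Doeblin
condition for the conditional evolution. -/
lemma exists_integral_law_bounds (M : AbsorbedProcess Ω) {x0 : ℕ} (hx0 : x0 ≠ 0) {a : ℝ}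
    (ha : ∀ (r : ℝ≥0) (x : ℕ), a * M.surv (1 + r) x ≤ (M.law 1 x).real {x0} * M.surv r x0)
    {f : ℕ → ℝ} (hf0 : f 0 = 0) (hf : ∀ x, |f x| ≤ 1) (n : ℕ) (r : ℝ≥0) :
    ∃ m : ℝ, ∀ x, m * M.surv (n + r) x ≤ ∫ y, f y ∂M.law (n + r) x ∧
      ∫ y, f y ∂M.law (n + r) x ≤ (m + 2 * (1 - a) ^ n) * M.surv (n + r) x := by
  induction n with
  | zero =>
    have key (x : ℕ) : |∫ y, f y ∂M.law r x| ≤ M.surv r x := by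
      rw [surv_eq_integral]
      refine (abs_integral_le_integral_abs).trans (integral_mono (integrable_of_abs_le hf).abs
        (integrable_of_abs_le (C := 1) fun y => ?_) fun y => ?_)
      · by_cases hy : y = 0 <;> simp [hy]
      · by_cases hy : y = 0
        · simp [hy, hf0]
        · simpa [hy] using hf y
    refine ⟨-1, fun x => ?_⟩
    have := abs_le.1 (key x)
    simp only [Nat.cast_zero, zero_add, pow_zero]
    constructor <;> linarith
  | succ n ih =>
    obtain ⟨m, hm⟩ := ih
    set T : ℝ≥0 := n + r
    set D : ℝ := 2 * (1 - a) ^ n with hD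
    set S : ℕ → ℝ := fun y => ∫ z, f z ∂M.law T y with hS
    have hT : ((n + 1 : ℕ) : ℝ≥0) + r = 1 + T := by push_cast; ring
    have hSb (y : ℕ) : |S y| ≤ 1 := abs_integral_le_of_abs_le hf
    have hpos := M.surv_pos hx0 T
    obtain ⟨h, hh⟩ : ∃ h : ℝ, S x0 = (m + h) * M.surv T x0 :=
      ⟨S x0 / M.surv T x0 - m, by field_simp; ring⟩
    have hh0 : 0 ≤ h := by
      have := (hm x0).1
      nlinarith
    have hhD : h ≤ D := by
      have := (hm x0).2
      nlinarith
    refine ⟨m + a * h, fun x => ?_⟩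
    have hSi : Integrable S (M.law 1 x) := integrable_of_abs_le hSb
    have hsi (c : ℝ) : Integrable (fun y => c * M.surv T y) (M.law 1 x) :=
      (integrable_of_abs_le (M.abs_surv_le T)).const_mul c
    have hint : ∫ z, f z ∂M.law (1 + T) x = ∫ y, S y ∂M.law 1 x := M.integral_law_add 1 T x hf
    have hlow := real_singleton_mul_le_integral (hSi.sub (hsi m))
      (fun y => sub_nonneg.2 (hm y).1) x0
    have hupp := real_singleton_mul_le_integral ((hsi (m + D)).sub hSi)
      (fun y => sub_nonneg.2 (hm y).2) x0
    simp only [Pi.sub_apply] at hlow hupp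
    rw [integral_sub hSi (hsi m), integral_const_mul, ← surv_add, ← hint, hh] at hlow
    rw [integral_sub (hsi _) hSi, integral_const_mul, ← surv_add, ← hint, hh] at hupp
    have hax := ha T x
    rw [hT, pow_succ, ← mul_assoc, ← hD]
    constructor
    · nlinarith [mul_le_mul_of_nonneg_left hax hh0]
    · nlinarith [mul_le_mul_of_nonneg_left hax (sub_nonneg.2 hhD)]

/-- Under Hypothesis (H), the conditional evolution satisfies a Doeblin condition. -/
lemma doeblin_of_hypH (M : AbsorbedProcess Ω) {K : Set ℕ} {x0 : ℕ} {c1 c2 c3 c4 l0 : ℝ}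
    (hH : HypH M K x0 c1 c2 c3 c4 l0) (r : ℝ≥0) (x : ℕ) :
    c1 * c2 * c3 / (2 * c4) * M.surv (1 + r) x ≤ (M.law 1 x).real {x0} * M.surv r x0 := by
  have hle (y : ℕ) : M.surv r y ≤ c4 / (c2 * c3) * M.surv r x0 := by
    have := M.law_compl_le_of_hypH hH r y
    obtain ⟨-, -, -, hc2, hc3, hc4, -⟩ := hH
    have := ENNReal.toReal_mono (by finiteness) this
    rwa [ENNReal.toReal_mul, ENNReal.toReal_ofReal (by positivity)] at this
  obtain ⟨-, -, hc1, hc2, hc3, hc4, -, H1, -⟩ := hH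
  rcases eq_or_ne x 0 with rfl | hx
  · rw [surv_zero_right, mul_zero]
    exact mul_nonneg measureReal_nonneg (M.surv_nonneg r x0)
  have h1 : c1 * M.surv 1 x ≤ (M.law 1 x).real {x0} := by
    have h := (H1 x hx).trans (measure_mono inter_subset_left)
    rw [measure_alive, show {ω | M.X 1 ω = x0} = {ω | M.X 1 ω ∈ ({x0} : Set ℕ)} from rfl,
      ← law_apply_set] at h
    have := ENNReal.toReal_mono (measure_ne_top _ _) h
    rwa [ENNReal.toReal_mul, ENNReal.toReal_ofReal hc1.le] at this
  have h2 : M.surv (1 + r) x ≤ c4 / (c2 * c3) * M.surv r x0 * M.surv 1 x := by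
    rw [surv_add, M.surv_eq_integral 1 x, ← integral_const_mul]
    refine integral_mono (integrable_of_abs_le (M.abs_surv_le r))
      ((integrable_of_abs_le (C := 1) fun y => ?_).const_mul _) fun y => ?_
    · by_cases hy : y = 0 <;> simp [hy]
    · by_cases hy : y = 0
      · simp [hy, surv_zero_right]
      · simpa [hy] using hle y
  have hr := M.surv_nonneg r x0
  have hs := M.surv_nonneg 1 x
  calc c1 * c2 * c3 / (2 * c4) * M.surv (1 + r) x
      ≤ c1 * c2 * c3 / (2 * c4) * (c4 / (c2 * c3) * M.surv r x0 * M.surv 1 x) := by gcongr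
    _ = 1 / 2 * ((c1 * M.surv 1 x) * M.surv r x0) := by field_simp
    _ ≤ (c1 * M.surv 1 x) * M.surv r x0 := by
        have : 0 ≤ (c1 * M.surv 1 x) * M.surv r x0 := by positivity
        linarith
    _ ≤ _ := by gcongr

lemma ae_bind_of_forall_ae {μ : Measure ℕ} {κ : Kernel ℕ Ω} {p : Ω → Prop}
    (h : ∀ x, ∀ᵐ ω ∂κ x, p ω) : ∀ᵐ ω ∂(κ ∘ₘ μ), p ω := by
  set N : Set Ω := ⋂ x, toMeasurable (κ x) {ω | ¬p ω}
  have hN : MeasurableSet N := .iInter fun x => measurableSet_toMeasurable _ _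
  have hN0 : (κ ∘ₘ μ) N = 0 := by
    rw [Measure.bind_apply hN κ.measurable.aemeasurable]
    refine (lintegral_congr fun x => ?_).trans lintegral_zero
    refine measure_mono_null (iInter_subset _ x) ?_
    rw [measure_toMeasurable]
    exact h x
  exact measure_mono_null (subset_iInter fun x => subset_toMeasurable _ _) hN0

lemma condDist_eq (M : AbsorbedProcess Ω) (μ : Measure ℕ) (t : ℝ≥0) :
    condDist M μ t = ((M.law t ∘ₘ μ) {0}ᶜ)⁻¹ • (M.law t ∘ₘ μ).restrict {0}ᶜ := by
  have hae : alive M t =ᵐ[Pmu M μ] M.X t ⁻¹' {0}ᶜ := by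
    have : ∀ᵐ ω ∂(M.kernel ∘ₘ μ), ω ∈ alive M t ↔ M.X t ω ≠ 0 :=
      ae_bind_of_forall_ae fun x => M.ae_mem_alive_iff x t
    exact this.mono fun ω h => propext h
  have hmap : (Pmu M μ).map (M.X t) = M.law t ∘ₘ μ :=
    Measure.map_comp μ M.kernel (M.meas t)
  rw [condDist, measure_congr hae, Measure.restrict_congr_set hae,
    ← Measure.restrict_map (M.meas t) MeasurableSet.of_discrete,
    ← Measure.map_apply (M.meas t) MeasurableSet.of_discrete, hmap]

lemma comp_law_compl_ne_zero (M : AbsorbedProcess Ω) {μ : Measure ℕ} [IsProbabilityMeasure μ]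
    (hμ : μ {0} = 0) (t : ℝ≥0) : (M.law t ∘ₘ μ) {0}ᶜ ≠ 0 := by
  rw [Measure.bind_apply MeasurableSet.of_discrete (Kernel.aemeasurable _)]
  intro h
  rw [lintegral_eq_zero_iff (measurable_of_countable _)] at h
  obtain ⟨x, hx, hx0⟩ := (h.and (measure_eq_zero_iff_ae_notMem.1 hμ)).exists
  exact (M.law_compl_pos hx0 t).ne' hx

lemma isFiniteMeasure_condDist (M : AbsorbedProcess Ω) {μ : Measure ℕ} [IsProbabilityMeasure μ]
    (hμ : μ {0} = 0) (t : ℝ≥0) : IsFiniteMeasure (condDist M μ t) := by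
  rw [condDist_eq]
  exact Measure.smul_finite _ (ENNReal.inv_ne_top.2 (M.comp_law_compl_ne_zero hμ t))

/-- Uniform bounds on `𝔼_x(f(X_t) ; t < T_0)` relative to `ℙ_x(t < T_0)` pass to the conditional
distributions with arbitrary initial law. -/
lemma integral_condDist_mem_Icc (M : AbsorbedProcess Ω) {μ : Measure ℕ} [IsProbabilityMeasure μ]
    (hμ : μ {0} = 0) {t : ℝ≥0} {f : ℕ → ℝ} (hf0 : f 0 = 0) (hf : ∀ x, |f x| ≤ 1) {m m' : ℝ}
    (hm : ∀ x, m * M.surv t x ≤ ∫ y, f y ∂M.law t x ∧ ∫ y, f y ∂M.law t x ≤ m' * M.surv t x) :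
    ∫ y, f y ∂condDist M μ t ∈ Icc m m' := by
  have hpos : 0 < (M.law t ∘ₘ μ).real {0}ᶜ :=
    ENNReal.toReal_pos (M.comp_law_compl_ne_zero hμ t) (measure_ne_top _ _)
  have hcomp {g : ℕ → ℝ} (hg : ∀ x, |g x| ≤ 1) :
      ∫ y, g y ∂(M.law t ∘ₘ μ) = ∫ x, ∫ y, g y ∂M.law t x ∂μ := by
    rw [Measure.comp_eq_comp_const_apply, Kernel.integral_comp (integrable_of_abs_le hg),
      Kernel.const_apply]
  have hsurv : (M.law t ∘ₘ μ).real {0}ᶜ = ∫ x, M.surv t x ∂μ := by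
    rw [← integral_indicator_one MeasurableSet.of_discrete, hcomp]
    · simp only [surv_eq_integral]
    · intro y
      by_cases hy : y = 0 <;> simp [hy]
  have hset : ∫ y in {0}ᶜ, f y ∂(M.law t ∘ₘ μ) = ∫ x, ∫ y, f y ∂M.law t x ∂μ := by
    rw [setIntegral_eq_integral_of_forall_compl_eq_zero, hcomp hf]
    intro y hy
    rw [not_not.1 hy, hf0]
  have hint : Integrable (fun x => ∫ y, f y ∂M.law t x) μ :=
    integrable_of_abs_le fun x => abs_integral_le_of_abs_le hf
  have hsi (c : ℝ) : Integrable (fun x => c * M.surv t x) μ :=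
    (integrable_of_abs_le (M.abs_surv_le t)).const_mul c
  rw [condDist_eq, integral_smul_measure, hset, ENNReal.toReal_inv, smul_eq_mul,
    ← measureReal_def, ← div_eq_inv_mul, mem_Icc, le_div_iff₀ hpos, div_le_iff₀ hpos, hsurv,
    ← integral_const_mul, ← integral_const_mul]
  exact ⟨integral_mono (hsi m) hint fun x => (hm x).1, integral_mono hint (hsi m') fun x => (hm x).2⟩

lemma abs_sign_le_one (a : ℝ) : |(SignType.sign a : ℝ)| ≤ 1 := by
  rcases SignType.sign a <;> simp

/-- The total variation distance is attained on a test function of sup norm at most one. -/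
lemma tvDist_eq_integral_sub (μ ν : Measure ℕ) [IsFiniteMeasure μ] [IsFiniteMeasure ν] :
    tvDist μ ν = ∫ x, (SignType.sign (μ.real {x} - ν.real {x}) : ℝ) ∂μ
      - ∫ x, (SignType.sign (μ.real {x} - ν.real {x}) : ℝ) ∂ν := by
  have hi (ρ : Measure ℕ) [IsFiniteMeasure ρ] :
      Integrable (fun x => (SignType.sign (μ.real {x} - ν.real {x}) : ℝ)) ρ :=
    integrable_of_abs_le fun x => abs_sign_le_one _
  have hs (ρ : Measure ℕ) [IsFiniteMeasure ρ] :
      Summable fun x => ρ.real {x} • (SignType.sign (μ.real {x} - ν.real {x}) : ℝ) := by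
    refine .of_norm_bounded (g := fun x => ρ.real {x}) ?_ fun x => ?_
    · refine ENNReal.summable_toReal ?_
      have := lintegral_countable' (μ := ρ) fun _ => 1
      simp only [lintegral_one, one_mul] at this
      exact this ▸ measure_ne_top ρ univ
    · rw [norm_smul, Real.norm_of_nonneg measureReal_nonneg]
      exact mul_le_of_le_one_right measureReal_nonneg (abs_sign_le_one _)
  rw [integral_countable (hi μ), integral_countable (hi ν), ← (hs μ).tsum_sub (hs ν), tvDist]
  refine tsum_congr fun x => ?_
  rw [← sub_smul, smul_eq_mul, self_mul_sign]
  rfl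

end AbsorbedProcess

/-- under Hypothesis (H), for all probability measures `μ`, `ν` on `ℕ*`
and all `t ≥ 0`,
`‖ℙ_μ(X_t ∈ · | t < T_0) − ℙ_ν(X_t ∈ · | t < T_0)‖_TV ≤ 2 (1 − c₁c₂c₃/(2c₄))^⌊t⌋`. -/
theorem mixing_of_hypH (M : AbsorbedProcess Ω) (K : Set ℕ) (x0 : ℕ)
    (c1 c2 c3 c4 l0 : ℝ) (hH : HypH M K x0 c1 c2 c3 c4 l0)
    (μ ν : Measure ℕ) [IsProbabilityMeasure μ] [IsProbabilityMeasure ν]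
    (hμ : μ {0} = 0) (hν : ν {0} = 0) (t : ℝ≥0) :
    tvDist (condDist M μ t) (condDist M ν t)
      ≤ 2 * (1 - c1 * c2 * c3 / (2 * c4)) ^ ⌊(t : ℝ)⌋₊ := by
  have hx0 : x0 ≠ 0 := fun h => hH.1 (h ▸ hH.2.1)
  have := M.isFiniteMeasure_condDist hμ t
  have := M.isFiniteMeasure_condDist hν t
  set f : ℕ → ℝ := fun x =>
    SignType.sign ((condDist M μ t).real {x} - (condDist M ν t).real {x}) with hfdef
  have hf0 : f 0 = 0 := by simp [hfdef, AbsorbedProcess.condDist_eq, measureReal_def]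
  have hf (x : ℕ) : |f x| ≤ 1 := AbsorbedProcess.abs_sign_le_one _
  obtain ⟨r, hr⟩ : ∃ r : ℝ≥0, (⌊(t : ℝ)⌋₊ : ℝ≥0) + r = t :=
    ⟨t - ⌊(t : ℝ)⌋₊, add_tsub_cancel_of_le (by exact_mod_cast Nat.floor_le t.2)⟩
  obtain ⟨m, hm⟩ := M.exists_integral_law_bounds hx0 (M.doeblin_of_hypH hH) hf0 hf ⌊(t : ℝ)⌋₊ r
  rw [hr] at hm
  have h1 := M.integral_condDist_mem_Icc hμ hf0 hf hm
  have h2 := M.integral_condDist_mem_Icc hν hf0 hf hm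
  rw [AbsorbedProcess.tvDist_eq_integral_sub]
  linarith [h1.2, h2.1]

end
end

section
/- Assume Hypothesis (H) and let ρ be the unique quasi-stationary distribution of X. Then for every probability measure μ on ℕ* and every t ≥ 0, ‖ℙ_μ(X_t ∈ · | t < T_0) − ρ‖_TV ≤ 2(1 − c_1c_2c_3/(2c_4))^⌊t⌋; in particular, ℙ_μ(X_t ∈ · | t < T_0) converges in total variation to ρ as t → ∞, for every initial distribution μ. -/
open MeasureTheory ENNReal Set Filter
open scoped NNReal ENNReal

noncomputable section

variable {Ω : Type*} [MeasurableSpace Ω]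

section AbsorbedProcess

variable (M : AbsorbedProcess Ω)

lemma hitT_le {K : Set ℕ} {t : ℝ≥0} {ω : Ω} (h : M.X t ω ∈ K) : hitT M K ω ≤ t :=
  iInf_le (fun t : {t : ℝ≥0 // M.X t ω ∈ K} => (t.1 : ℝ≥0∞)) ⟨t, h⟩

lemma exists_lt_of_hitT_lt {K : Set ℕ} {r : ℝ≥0∞} {ω : Ω} (h : hitT M K ω < r) :
    ∃ t : ℝ≥0, M.X t ω ∈ K ∧ (t : ℝ≥0∞) < r := by
  obtain ⟨⟨t, ht⟩, hr⟩ := iInf_lt_iff.1 h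
  exact ⟨t, ht, hr⟩

lemma alive_ae_iff (x : ℕ) (t : ℝ≥0) : ∀ᵐ ω ∂M.P x, ω ∈ alive M t ↔ M.X t ω ≠ 0 := by
  filter_upwards [M.rightCont x, M.absorbing x] with ω hr ha
  refine ⟨fun h h0 => absurd (hitT_le M (K := {0}) h0) (not_le.2 h), fun h => ?_⟩
  obtain ⟨ε, hε, hc⟩ := hr t
  have hlt : (t : ℝ≥0∞) < ((t + ε : ℝ≥0) : ℝ≥0∞) := by
    exact_mod_cast lt_add_of_pos_right t hε
  refine hlt.trans_le (le_of_not_gt fun hh => ?_)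
  obtain ⟨s, hs, hst⟩ := exists_lt_of_hitT_lt M hh
  have hst : s < t + ε := by exact_mod_cast hst
  rcases le_total s t with h1 | h1
  · exact h (ha s t h1 hs)
  · exact h ((hc s h1 hst).symm.trans hs)

lemma ae_Pmu (μ : Measure ℕ) {q : Ω → Prop} (h : ∀ x, ∀ᵐ ω ∂M.P x, q ω) :
    ∀ᵐ ω ∂Pmu M μ, q ω := by
  have hsub : {ω | ¬ q ω} ⊆ ⋂ x, toMeasurable (M.P x) {ω | ¬ q ω} :=
    subset_iInter fun x => subset_toMeasurable _ _
  refine measure_mono_null hsub ?_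
  have hm : MeasurableSet (⋂ x, toMeasurable (M.P x) {ω | ¬ q ω}) :=
    MeasurableSet.iInter fun x => measurableSet_toMeasurable _ _
  rw [Pmu, Measure.bind_apply hm (measurable_of_countable _).aemeasurable]
  refine lintegral_eq_zero_of_ae_eq_zero (Eventually.of_forall fun x => ?_)
  refine measure_mono_null (iInter_subset _ x) ?_
  rw [measure_toMeasurable]
  exact h x

lemma Pmu_apply (μ : Measure ℕ) {s : Set Ω} (hs : MeasurableSet s) :
    Pmu M μ s = ∑' x, M.P x s * μ {x} := by
  rw [Pmu, Measure.bind_apply hs (measurable_of_countable _).aemeasurable, lintegral_countable']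

lemma measurable_path : Measurable fun ω => fun u => M.X u ω :=
  measurable_pi_lambda _ fun u => M.meas u

lemma ae_init (x : ℕ) : ∀ᵐ ω ∂M.P x, M.X 0 ω = x := by
  have := M.prob x
  exact (mem_ae_iff_prob_eq_one (M.meas 0 (measurableSet_singleton x))).2 (M.init x)

lemma lintegral_shift (x : ℕ) (s : ℝ≥0) {F : (ℝ≥0 → ℕ) → ℝ≥0∞} (hF : Measurable F) :
    ∫⁻ ω, F (fun u => M.X (s + u) ω) ∂M.P x
      = ∑' y, M.P x {ω | M.X s ω = y} * ∫⁻ ω, F (fun u => M.X u ω) ∂M.P y := by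
  have hsh : Measurable fun ω => fun u => M.X (s + u) ω :=
    measurable_pi_lambda _ fun u => M.meas (s + u)
  have hms (y : ℕ) : MeasurableSet {ω | M.X s ω = y} := M.meas s (measurableSet_singleton y)
  have hmap (y : ℕ) : ((M.P x).restrict {ω | M.X s ω = y}).map (fun ω => fun u => M.X (s + u) ω)
      = M.P x {ω | M.X s ω = y} • (M.P y).map (fun ω => fun u => M.X u ω) := by
    ext B hB
    rw [Measure.map_apply hsh hB, Measure.restrict_apply (hsh hB), Measure.smul_apply,
      Measure.map_apply (measurable_path M) hB, inter_comm, smul_eq_mul]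
    exact M.markov x y s B hB
  have huniv : (⋃ y, {ω | M.X s ω = y}) = univ := by ext; simp
  rw [← setLIntegral_univ, ← huniv, lintegral_iUnion hms]
  · refine tsum_congr fun y => ?_
    rw [← lintegral_map hF hsh, hmap, lintegral_smul_measure, smul_eq_mul,
      lintegral_map hF (measurable_path M)]
  · intro a b hab
    rw [Function.onFun, Set.disjoint_left]
    exact fun ω h1 h2 => hab (h1.symm.trans h2)

lemma chapman_kolmogorov (x : ℕ) (s t : ℝ≥0) (B : Set ℕ) :
    M.P x {ω | M.X (s + t) ω ∈ B}
      = ∑' y, M.P x {ω | M.X s ω = y} * M.P y {ω | M.X t ω ∈ B} := by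
  have hm : MeasurableSet {w : ℝ≥0 → ℕ | w t ∈ B} :=
    measurable_pi_apply t (MeasurableSet.of_discrete (s := B))
  have hmB (u : ℝ≥0) : MeasurableSet {ω | M.X u ω ∈ B} := M.meas u (MeasurableSet.of_discrete)
  have hind (u : ℝ≥0) (z : ℕ) :
      ∫⁻ ω, {ω | M.X u ω ∈ B}.indicator (fun _ => (1 : ℝ≥0∞)) ω ∂M.P z
        = M.P z {ω | M.X u ω ∈ B} := by
    rw [lintegral_indicator_const (hmB u), one_mul]
  rw [← hind]
  refine (lintegral_shift M x s (F := {w : ℝ≥0 → ℕ | w t ∈ B}.indicator fun _ => (1 : ℝ≥0∞))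
    (measurable_const.indicator hm)).trans (tsum_congr fun y => ?_)
  rw [← hind]
  rfl

lemma chapman_kolmogorov_survival (x : ℕ) (s t : ℝ≥0) :
    M.P x {ω | M.X (s + t) ω ≠ 0}
      = ∑' y, M.P x {ω | M.X s ω = y} * M.P y {ω | M.X t ω ≠ 0} :=
  chapman_kolmogorov M x s t {0}ᶜ

lemma measure_alive (x : ℕ) (t : ℝ≥0) : M.P x (alive M t) = M.P x {ω | M.X t ω ≠ 0} :=
  measure_congr (eventuallyEq_set.2 (alive_ae_iff M x t))

lemma survival_zero (t : ℝ≥0) : M.P 0 {ω | M.X t ω ≠ 0} = 0 := by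
  refine measure_eq_zero_iff_ae_notMem.2 ?_
  filter_upwards [ae_init M 0, M.absorbing 0] with ω h0 ha
  simpa using ha 0 t zero_le h0

lemma survival_time_zero {x : ℕ} (hx : x ≠ 0) : M.P x {ω | M.X 0 ω ≠ 0} = 1 := by
  have := M.prob x
  refine (measure_congr (eventuallyEq_univ.2 ?_)).trans (measure_univ (μ := M.P x))
  filter_upwards [ae_init M x] with ω h
  simpa [h] using hx

lemma survival_pos {x : ℕ} (hx : x ≠ 0) (t : ℝ≥0) : M.P x {ω | M.X t ω ≠ 0} ≠ 0 := by
  have hp := M.prob x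
  have hex : ∃ n : ℕ, M.P x {ω | M.X (t / (n + 1)) ω = x} ≠ 0 := by
    by_contra! hall
    have h1 : ∀ᵐ ω ∂M.P x, ∀ n : ℕ, ¬ M.X (t / (n + 1)) ω = x :=
      ae_all_iff.2 fun n => measure_eq_zero_iff_ae_notMem.1 (hall n)
    have hF : ∀ᵐ ω ∂M.P x, False := by
      filter_upwards [h1, ae_init M x, M.rightCont x] with ω h h0 hr
      obtain ⟨ε, hε, hc⟩ := hr 0
      obtain ⟨n, hn⟩ := exists_nat_gt (t / ε)
      refine h n ((hc _ zero_le ?_).trans h0)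
      rw [zero_add, div_lt_iff₀ (by positivity)]
      rw [div_lt_iff₀ hε] at hn
      calc t < n * ε := hn
        _ ≤ ε * (n + 1) := by rw [mul_comm]; gcongr; simp
    simp only [eventually_false_iff_eq_bot, ae_eq_bot] at hF
    exact IsProbabilityMeasure.ne_zero _ hF
  obtain ⟨n, hn⟩ := hex
  have hk : ∀ k : ℕ, M.P x {ω | M.X (k * (t / (n + 1))) ω = x} ≠ 0 := by
    intro k
    induction k with
    | zero => simpa using (M.init x).symm ▸ one_ne_zero
    | succ k ih =>
      have h := chapman_kolmogorov M x (k * (t / (n + 1))) (t / (n + 1)) {x}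
      simp only [mem_singleton_iff] at h
      rw [show ((k + 1 : ℕ) : ℝ≥0) * (t / (n + 1)) = k * (t / (n + 1)) + t / (n + 1) by
        push_cast; ring, h, Ne, ENNReal.tsum_eq_zero]
      exact fun h0 => mul_ne_zero ih hn (h0 x)
  have := hk (n + 1)
  rw [show ((n + 1 : ℕ) : ℝ≥0) * (t / (n + 1)) = t by push_cast; field_simp] at this
  refine fun h0 => this (measure_mono_null ?_ h0)
  rintro ω rfl
  exact hx

/-- The factor `E ^ j` where `j` is the first index with `w (j * δ) ∈ A`, truncated at `n`. -/
def gridFactor (E : ℝ≥0∞) (δ : ℝ≥0) (A : Set ℕ) : ℕ → (ℝ≥0 → ℕ) → ℝ≥0∞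
  | 0, _ => 1
  | n + 1, w => {v : ℝ≥0 → ℕ | v 0 ∈ A}.indicator (fun _ => 1) w
      + {v : ℝ≥0 → ℕ | v 0 ∈ A}ᶜ.indicator
        (fun v => E * gridFactor E δ A n fun u => v (δ + u)) w

section gridFactor

variable {E : ℝ≥0∞} {δ : ℝ≥0} {A : Set ℕ}

lemma gridFactor_succ_of_mem {n : ℕ} {w : ℝ≥0 → ℕ} (h : w 0 ∈ A) :
    gridFactor E δ A (n + 1) w = 1 := by
  simp [gridFactor, h]

lemma gridFactor_succ_of_notMem {n : ℕ} {w : ℝ≥0 → ℕ} (h : w 0 ∉ A) :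
    gridFactor E δ A (n + 1) w = E * gridFactor E δ A n fun u => w (δ + u) := by
  simp [gridFactor, h]

lemma measurable_gridFactor (n : ℕ) : Measurable (gridFactor E δ A n) := by
  induction n with
  | zero => exact measurable_const
  | succ n ih =>
    have hm : MeasurableSet {v : ℝ≥0 → ℕ | v 0 ∈ A} :=
      measurable_pi_apply 0 (MeasurableSet.of_discrete (s := A))
    refine (measurable_const.indicator hm).add (Measurable.indicator ?_ hm.compl)
    exact (ih.comp (measurable_pi_lambda _ fun u => measurable_pi_apply (δ + u))).const_mul E

lemma one_le_gridFactor (hE : 1 ≤ E) (n : ℕ) (w : ℝ≥0 → ℕ) : 1 ≤ gridFactor E δ A n w := by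
  induction n generalizing w with
  | zero => exact le_rfl
  | succ n ih =>
    by_cases h : w 0 ∈ A
    · exact (gridFactor_succ_of_mem h).ge
    · rw [gridFactor_succ_of_notMem h]
      exact one_le_mul hE (ih _)

lemma gridFactor_le_pow (hE : 1 ≤ E) (n : ℕ) (w : ℝ≥0 → ℕ) : gridFactor E δ A n w ≤ E ^ n := by
  induction n generalizing w with
  | zero => simp [gridFactor]
  | succ n ih =>
    by_cases h : w 0 ∈ A
    · rw [gridFactor_succ_of_mem h]
      exact one_le_pow_of_one_le' hE _
    · rw [gridFactor_succ_of_notMem h, pow_succ']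
      gcongr
      exact ih _

lemma gridFactor_le_pow_of_mem (hE : 1 ≤ E) (n k : ℕ) (w : ℝ≥0 → ℕ) (hk : w (k * δ) ∈ A) :
    gridFactor E δ A n w ≤ E ^ k := by
  induction n generalizing w k with
  | zero => exact one_le_pow_of_one_le' hE _
  | succ n ih =>
    by_cases h : w 0 ∈ A
    · rw [gridFactor_succ_of_mem h]
      exact one_le_pow_of_one_le' hE _
    · rw [gridFactor_succ_of_notMem h]
      cases k with
      | zero => simp [h] at hk
      | succ k =>
        rw [pow_succ']
        gcongr
        refine ih k _ ?_
        rwa [show δ + k * δ = (k + 1 : ℕ) * δ by push_cast; ring]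

end gridFactor

lemma survival_le_of_mem {K : Set ℕ} {x0 : ℕ} {c2 c3 l0 : ℝ} (hc2 : 0 < c2)
    (h2 : ∀ t : ℝ≥0, ∀ x ∈ K, ∀ y ∈ K,
      ENNReal.ofReal c2 * M.P y (alive M t) ≤ M.P x (alive M t))
    (h3 : ∀ t : ℝ≥0, ENNReal.ofReal (c3 * Real.exp (-(l0 * (t : ℝ)))) ≤ M.P x0 {ω | M.X t ω ∈ K})
    (s r : ℝ≥0) {y : ℕ} (hy : y ∈ K) :
    ENNReal.ofReal (c2 * c3) * M.P y {ω | M.X r ω ≠ 0}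
      ≤ ENNReal.ofReal (Real.exp (l0 * s)) * M.P x0 {ω | M.X (s + r) ω ≠ 0} := by
  have hs : M.P x0 {ω | M.X s ω ∈ K} * (ENNReal.ofReal c2 * M.P y {ω | M.X r ω ≠ 0})
      ≤ M.P x0 {ω | M.X (s + r) ω ≠ 0} := by
    have h := chapman_kolmogorov M x0 s 0 K
    rw [add_zero] at h
    rw [h, chapman_kolmogorov_survival, ← ENNReal.tsum_mul_right]
    refine ENNReal.tsum_le_tsum fun z => ?_
    rw [mul_assoc]
    gcongr
    by_cases hz : z ∈ K
    · have := M.prob z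
      have h2' := h2 r z hz y hy
      rw [measure_alive, measure_alive] at h2'
      exact (mul_le_of_le_one_left zero_le prob_le_one).trans h2'
    · have h0 : M.P z {ω | M.X 0 ω ∈ K} = 0 := by
        refine measure_eq_zero_iff_ae_notMem.2 ?_
        filter_upwards [ae_init M z] with ω h
        simpa [h] using hz
      simp [h0]
  calc ENNReal.ofReal (c2 * c3) * M.P y {ω | M.X r ω ≠ 0}
      = ENNReal.ofReal (Real.exp (l0 * s)) * (ENNReal.ofReal (c3 * Real.exp (-(l0 * (s : ℝ))))
          * (ENNReal.ofReal c2 * M.P y {ω | M.X r ω ≠ 0})) := by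
        rw [← mul_assoc, ← mul_assoc, ← ENNReal.ofReal_mul (Real.exp_pos _).le,
          ← ENNReal.ofReal_mul' hc2.le]
        congr 2
        rw [mul_left_comm, ← Real.exp_add, add_neg_cancel, Real.exp_zero]
        ring
    _ ≤ _ := by
        gcongr
        refine le_trans ?_ hs
        gcongr
        exact h3 s

lemma survival_le_mul_gridFactor {K : Set ℕ} {x0 : ℕ} {c2 c3 l0 : ℝ} (hx0 : x0 ∈ K) (h0K : 0 ∉ K)
    (hc2 : 0 < c2) (hl0 : 0 < l0)
    (h2 : ∀ t : ℝ≥0, ∀ x ∈ K, ∀ y ∈ K,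
      ENNReal.ofReal c2 * M.P y (alive M t) ≤ M.P x (alive M t))
    (h3 : ∀ t : ℝ≥0, ENNReal.ofReal (c3 * Real.exp (-(l0 * (t : ℝ)))) ≤ M.P x0 {ω | M.X t ω ∈ K})
    (δ : ℝ≥0) (n j i : ℕ) (hij : i + j = n) (x : ℕ) :
    ENNReal.ofReal (c2 * c3) * M.P x {ω | M.X (j * δ) ω ≠ 0}
      ≤ M.P x0 {ω | M.X (n * δ) ω ≠ 0} * (ENNReal.ofReal (Real.exp (l0 * δ)) ^ i *
        ∫⁻ ω, gridFactor (ENNReal.ofReal (Real.exp (l0 * δ))) δ (insert 0 K) j (fun u => M.X u ω)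
          ∂M.P x) := by
  have hpow (k : ℕ) : ENNReal.ofReal (Real.exp (l0 * δ)) ^ k
      = ENNReal.ofReal (Real.exp (l0 * ((k * δ : ℝ≥0) : ℝ))) := by
    rw [← ENNReal.ofReal_pow (Real.exp_pos _).le, ← Real.exp_nat_mul]
    push_cast
    ring_nf
  have hE : 1 ≤ ENNReal.ofReal (Real.exp (l0 * δ)) := by
    rw [ENNReal.one_le_ofReal]
    exact Real.one_le_exp (by positivity)
  have hint (k z : ℕ) : 1 ≤ ∫⁻ ω, gridFactor (ENNReal.ofReal (Real.exp (l0 * δ))) δ (insert 0 K) k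
      (fun u => M.X u ω) ∂M.P z := by
    have := M.prob z
    calc (1 : ℝ≥0∞) = ∫⁻ ω, 1 ∂M.P z := by simp
      _ ≤ _ := lintegral_mono fun ω => one_le_gridFactor hE k _
  induction j generalizing x i with
  | zero =>
    have := M.prob x
    have h := survival_le_of_mem M hc2 h2 h3 (n * δ) 0 hx0
    rw [survival_time_zero M (fun h => h0K (h ▸ hx0)), mul_one, add_zero] at h
    obtain rfl : i = n := by simpa using hij
    rw [hpow]
    calc _ ≤ ENNReal.ofReal (c2 * c3) := mul_le_of_le_one_right zero_le prob_le_one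
      _ ≤ _ := h
      _ = M.P x0 {ω | M.X (i * δ) ω ≠ 0}
          * (ENNReal.ofReal (Real.exp (l0 * ((i * δ : ℝ≥0) : ℝ))) * 1) := by rw [mul_one, mul_comm]
      _ ≤ _ := by gcongr; exact hint 0 x
  | succ j ih =>
    by_cases hxK : x ∈ K
    · have h := survival_le_of_mem M hc2 h2 h3 (i * δ) ((j + 1 : ℕ) * δ) hxK
      rw [← add_mul, ← Nat.cast_add, hij, ← hpow] at h
      calc _ ≤ _ := h
        _ = M.P x0 {ω | M.X (n * δ) ω ≠ 0} * (ENNReal.ofReal (Real.exp (l0 * δ)) ^ i * 1) := by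
          rw [mul_one, mul_comm]
        _ ≤ _ := by gcongr; exact hint _ x
    by_cases hx : x = 0
    · subst hx
      simp [survival_zero]
    have hA : x ∉ insert 0 K := by simp [hx, hxK]
    have hstep : ∫⁻ ω, gridFactor (ENNReal.ofReal (Real.exp (l0 * δ))) δ (insert 0 K) (j + 1)
        (fun u => M.X u ω) ∂M.P x = ENNReal.ofReal (Real.exp (l0 * δ)) *
        ∑' y, M.P x {ω | M.X δ ω = y} * ∫⁻ ω, gridFactor (ENNReal.ofReal (Real.exp (l0 * δ))) δ
          (insert 0 K) j (fun u => M.X u ω) ∂M.P y := by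
      rw [← lintegral_shift M x δ (measurable_gridFactor j),
        ← lintegral_const_mul' _ _ ENNReal.ofReal_ne_top]
      refine lintegral_congr_ae ?_
      filter_upwards [ae_init M x] with ω h
      exact gridFactor_succ_of_notMem (by rwa [h])
    rw [hstep, ← mul_assoc (_ ^ i), ← pow_succ, ← mul_assoc, ← ENNReal.tsum_mul_left,
      show ((j + 1 : ℕ) : ℝ≥0) * δ = δ + j * δ by push_cast; ring, chapman_kolmogorov_survival,
      ← ENNReal.tsum_mul_left]
    refine ENNReal.tsum_le_tsum fun y => ?_
    have h := ih (i + 1) (by omega) y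
    calc _ = M.P x {ω | M.X δ ω = y}
          * (ENNReal.ofReal (c2 * c3) * M.P y {ω | M.X (j * δ) ω ≠ 0}) := by ring
      _ ≤ _ := mul_le_mul_right h _
      _ = _ := by ring

lemma limsup_gridFactor_le {K : Set ℕ} {l0 : ℝ} (hl0 : 0 < l0) (t : ℝ≥0) (x : ℕ) :
    ∀ᵐ ω ∂M.P x, limsup (fun n : ℕ => gridFactor
        (ENNReal.ofReal (Real.exp (l0 * (t / (n + 1) : ℝ≥0)))) (t / (n + 1)) (insert 0 K) (n + 1)
        (fun u => M.X u ω)) atTop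
      ≤ expE l0 (min (hitT M K ω) (hitT M {0} ω)) := by
  filter_upwards [M.rightCont x] with ω hr
  have hpow (n k : ℕ) : ENNReal.ofReal (Real.exp (l0 * (t / (n + 1) : ℝ≥0))) ^ k
      = ENNReal.ofReal (Real.exp (l0 * ((k * (t / (n + 1)) : ℝ≥0) : ℝ))) := by
    rw [← ENNReal.ofReal_pow (Real.exp_pos _).le, ← Real.exp_nat_mul]
    push_cast
    ring_nf
  have hE (n : ℕ) : 1 ≤ ENNReal.ofReal (Real.exp (l0 * (t / (n + 1) : ℝ≥0))) := by
    rw [ENNReal.one_le_ofReal]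
    exact Real.one_le_exp (by positivity)
  unfold expE
  split_ifs with htop
  · exact le_top
  lift min (hitT M K ω) (hitT M {0} ω) to ℝ≥0 using htop with τ hτ
  rw [ENNReal.coe_toReal]
  have key : ∀ r : ℝ≥0, τ < r → limsup (fun n : ℕ => gridFactor
        (ENNReal.ofReal (Real.exp (l0 * (t / (n + 1) : ℝ≥0)))) (t / (n + 1)) (insert 0 K) (n + 1)
        (fun u => M.X u ω)) atTop ≤ ENNReal.ofReal (Real.exp (l0 * r)) := by
    intro r hτr
    have hτr' : min (hitT M K ω) (hitT M {0} ω) < r := by rw [← hτ]; exact_mod_cast hτr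
    obtain ⟨s, hs, hsr⟩ : ∃ s : ℝ≥0, M.X s ω ∈ insert 0 K ∧ s < r := by
      rcases min_lt_iff.1 hτr' with h | h
      · obtain ⟨s, h1, h2⟩ := exists_lt_of_hitT_lt M h
        exact ⟨s, mem_insert_of_mem _ h1, by exact_mod_cast h2⟩
      · obtain ⟨s, h1, h2⟩ := exists_lt_of_hitT_lt M h
        exact ⟨s, Or.inl h1, by exact_mod_cast h2⟩
    obtain ⟨ε, hε, hc⟩ := hr s
    refine Filter.limsup_le_of_le isCobounded_le_of_bot ?_
    obtain ⟨N, hN⟩ := exists_nat_gt (t / min ε (r - s))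
    have hpos : 0 < min ε (r - s) := lt_min hε (tsub_pos_of_lt hsr)
    filter_upwards [eventually_ge_atTop N] with n hn
    rcases eq_or_ne t 0 with rfl | ht
    · refine (gridFactor_le_pow (hE n) _ _).trans ?_
      rw [hpow]
      gcongr
      simp
    have hδ : t / (n + 1) < min ε (r - s) := by
      rw [div_lt_iff₀ (by positivity)]
      rw [div_lt_iff₀ hpos] at hN
      calc t < N * min ε (r - s) := hN
        _ ≤ min ε (r - s) * (n + 1) := by
          rw [mul_comm]
          gcongr
          exact_mod_cast hn.trans (Nat.le_succ n)
    have hδ0 : 0 < t / (n + 1) := by positivity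
    set δ := t / (n + 1) with hδdef
    have h1 : s ≤ ⌈s / δ⌉₊ * δ := by
      rw [← div_le_iff₀ hδ0]
      exact Nat.le_ceil _
    have h2 : ⌈s / δ⌉₊ * δ < s + min ε (r - s) := by
      calc (⌈s / δ⌉₊ : ℝ≥0) * δ < (s / δ + 1) * δ := by
            gcongr
            exact Nat.ceil_lt_add_one zero_le
        _ = s + δ := by field_simp
        _ < _ := by gcongr
    refine (gridFactor_le_pow_of_mem (hE n) _ ⌈s / δ⌉₊ _ ?_).trans ?_
    · rwa [hc _ h1 (h2.trans_le (by gcongr; exact min_le_left _ _))]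
    · rw [hpow]
      gcongr
      refine h2.le.trans ((add_le_add_right (min_le_right _ _) s).trans ?_)
      rw [add_tsub_cancel_of_le hsr.le]
  have hcont : Tendsto (fun r : ℝ≥0 => ENNReal.ofReal (Real.exp (l0 * r))) (nhdsWithin τ (Ioi τ))
      (nhds (ENNReal.ofReal (Real.exp (l0 * τ)))) := by
    refine Tendsto.mono_left (Continuous.tendsto ?_ τ) nhdsWithin_le_nhds
    exact ENNReal.continuous_ofReal.comp (by fun_prop)
  refine ge_of_tendsto hcont ?_
  filter_upwards [self_mem_nhdsWithin] with r hr
  exact key r hr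

lemma survival_le_survival_base {K : Set ℕ} {x0 : ℕ} {c1 c2 c3 c4 l0 : ℝ}
    (hH : HypH M K x0 c1 c2 c3 c4 l0) (t : ℝ≥0) {x : ℕ} (hx : x ≠ 0) :
    ENNReal.ofReal (c2 * c3) * M.P x {ω | M.X t ω ≠ 0}
      ≤ ENNReal.ofReal c4 * M.P x0 {ω | M.X t ω ≠ 0} := by
  obtain ⟨h0K, hx0, hc1, hc2, hc3, hc4, hl0, h1, h2, h3, h4⟩ := hH
  have hx00 : x0 ≠ 0 := fun h => h0K (h ▸ hx0)
  have := M.prob x0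
  have := M.prob x
  have hH0 := survival_pos M hx00 t
  rw [← ENNReal.div_le_iff hH0 (measure_ne_top _ _)]
  set E : ℕ → ℝ≥0∞ := fun n => ENNReal.ofReal (Real.exp (l0 * (t / (n + 1) : ℝ≥0)))
  set f : ℕ → Ω → ℝ≥0∞ := fun n ω => gridFactor (E n) (t / (n + 1)) (insert 0 K) (n + 1)
        (fun u => M.X u ω) with hf
  have hle (n : ℕ) : ENNReal.ofReal (c2 * c3) * M.P x {ω | M.X t ω ≠ 0}
      / M.P x0 {ω | M.X t ω ≠ 0} ≤ ∫⁻ ω, f n ω ∂M.P x := by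
    have h := survival_le_mul_gridFactor M hx0 h0K hc2 hl0 h2 h3 (t / (n + 1))
      (n + 1) (n + 1) 0 (by simp) x
    rw [show ((n + 1 : ℕ) : ℝ≥0) * (t / (n + 1)) = t by push_cast; field_simp, pow_zero,
      one_mul, mul_comm (M.P x0 _)] at h
    exact ENNReal.div_le_of_le_mul h
  calc _ ≤ limsup (fun n => ∫⁻ ω, f n ω ∂M.P x) atTop :=
        le_limsup_of_frequently_le' (Frequently.of_forall hle)
    _ ≤ ∫⁻ ω, limsup (fun n => f n ω) atTop ∂M.P x := by
        refine limsup_lintegral_le (fun _ => ENNReal.ofReal (Real.exp (l0 * t)))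
          (fun n => (measurable_gridFactor _).comp (measurable_path M)) (fun n => ?_) ?_
        · refine Eventually.of_forall fun ω => ?_
          have hE : 1 ≤ E n := by
            rw [ENNReal.one_le_ofReal]
            exact Real.one_le_exp (by positivity)
          refine (gridFactor_le_pow hE _ _).trans (le_of_eq ?_)
          rw [← ENNReal.ofReal_pow (Real.exp_pos _).le, ← Real.exp_nat_mul]
          push_cast
          congr 2
          field_simp
        · simp
    _ ≤ ∫⁻ ω, expE l0 (min (hitT M K ω) (hitT M {0} ω)) ∂M.P x :=
        lintegral_mono_ae (limsup_gridFactor_le M hl0 t x)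
    _ ≤ _ := h4 x hx

lemma doeblin_minorization {K : Set ℕ} {x0 : ℕ} {c1 c2 c3 c4 l0 : ℝ}
    (hH : HypH M K x0 c1 c2 c3 c4 l0) (s : ℝ≥0) (x : ℕ) :
    ENNReal.ofReal (c1 * (c2 * c3)) * M.P x {ω | M.X (1 + s) ω ≠ 0}
      ≤ ENNReal.ofReal c4 * (M.P x {ω | M.X 1 ω = x0} * M.P x0 {ω | M.X s ω ≠ 0}) := by
  have hA := fun y (hy : y ≠ 0) => survival_le_survival_base M hH s hy
  obtain ⟨h0K, hx0, hc1, hc2, hc3, hc4, hl0, h1, h2, h3, h4⟩ := hH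
  rcases eq_or_ne x 0 with rfl | hx
  · simp [survival_zero]
  have hB : ENNReal.ofReal (c2 * c3) * M.P x {ω | M.X (1 + s) ω ≠ 0}
      ≤ ENNReal.ofReal c4 * M.P x0 {ω | M.X s ω ≠ 0} * M.P x {ω | M.X 1 ω ≠ 0} := by
    have hone := chapman_kolmogorov_survival M x 1 0
    rw [add_zero] at hone
    rw [hone, chapman_kolmogorov_survival, ← ENNReal.tsum_mul_left, ← ENNReal.tsum_mul_left]
    refine ENNReal.tsum_le_tsum fun y => ?_
    rcases eq_or_ne y 0 with rfl | hy
    · simp [survival_zero]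
    rw [survival_time_zero M hy, mul_one, mul_left_comm, mul_comm _ (M.P x _)]
    exact mul_le_mul_right (hA y hy) _
  have h1' := h1 x hx
  rw [measure_alive] at h1'
  calc _ = ENNReal.ofReal c1
        * (ENNReal.ofReal (c2 * c3) * M.P x {ω | M.X (1 + s) ω ≠ 0}) := by
        rw [ENNReal.ofReal_mul hc1.le, mul_assoc]
    _ ≤ _ := mul_le_mul_right hB _
    _ = ENNReal.ofReal c4 * ((ENNReal.ofReal c1 * M.P x {ω | M.X 1 ω ≠ 0})
        * M.P x0 {ω | M.X s ω ≠ 0}) := by ring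
    _ ≤ _ := by
        gcongr
        exact h1'.trans (measure_mono inter_subset_left)

section WeightedContraction

variable {η u v : ℕ → ℝ} {p : ℕ → ℕ → ℝ}

lemma summable_abs_mul_kernel (hη : Summable fun x => |η x|) (hp0 : ∀ x y, 0 ≤ p x y)
    (hp1 : ∀ x, HasSum (p x) 1) : Summable fun z : ℕ × ℕ => |η z.1| * p z.1 z.2 := by
  have h0 : 0 ≤ fun z : ℕ × ℕ => |η z.1| * p z.1 z.2 :=
    fun z => mul_nonneg (abs_nonneg _) (hp0 _ _)
  rw [summable_prod_of_nonneg h0]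
  refine ⟨fun x => (hp1 x).summable.mul_left |η x|, ?_⟩
  simpa only [tsum_mul_left, (hp1 _).tsum_eq, mul_one] using hη

lemma summable_mul_kernel (hη : Summable fun x => |η x|) (hp0 : ∀ x y, 0 ≤ p x y)
    (hp1 : ∀ x, HasSum (p x) 1) : Summable fun z : ℕ × ℕ => η z.1 * p z.1 z.2 := by
  refine Summable.of_norm ?_
  simpa [abs_mul, abs_of_nonneg (hp0 _ _)] using summable_abs_mul_kernel hη hp0 hp1

lemma summable_abs_tsum_mul_kernel (hη : Summable fun x => |η x|) (hp0 : ∀ x y, 0 ≤ p x y)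
    (hp1 : ∀ x, HasSum (p x) 1) : Summable fun y => |∑' x, η x * p x y| :=
  (summable_mul_kernel hη hp0 hp1).prod_symm.prod.abs

lemma tsum_tsum_mul_kernel_mul (hη : Summable fun x => |η x|) (hp0 : ∀ x y, 0 ≤ p x y)
    (hp1 : ∀ x, HasSum (p x) 1) (hu0 : ∀ y, 0 ≤ u y) (hu1 : ∀ y, u y ≤ 1)
    (hv : ∀ x, HasSum (fun y => p x y * u y) (v x)) :
    ∑' y, (∑' x, η x * p x y) * u y = ∑' x, η x * v x := by
  have hs : Summable fun z : ℕ × ℕ => η z.1 * (p z.1 z.2 * u z.2) := by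
    refine Summable.of_norm_bounded (summable_abs_mul_kernel hη hp0 hp1) fun z => ?_
    rw [Real.norm_eq_abs, abs_mul, abs_of_nonneg (mul_nonneg (hp0 _ _) (hu0 _))]
    exact mul_le_mul_of_nonneg_left (mul_le_of_le_one_right (hp0 _ _) (hu1 _)) (abs_nonneg _)
  calc ∑' y, (∑' x, η x * p x y) * u y = ∑' y, ∑' x, η x * (p x y * u y) := by
        simp_rw [← tsum_mul_right, mul_assoc]
    _ = ∑' x, ∑' y, η x * (p x y * u y) :=
        Summable.tsum_comm (f := fun x y => η x * (p x y * u y)) hs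
    _ = ∑' x, η x * v x := by simp_rw [tsum_mul_left, (hv _).tsum_eq]

lemma tsum_abs_tsum_mul_kernel_le (hη : Summable fun x => |η x|) (hp0 : ∀ x y, 0 ≤ p x y)
    (hp1 : ∀ x, HasSum (p x) 1) (hu0 : ∀ y, 0 ≤ u y) (hu1 : ∀ y, u y ≤ 1)
    (hv : ∀ x, HasSum (fun y => p x y * u y) (v x)) {c : ℝ} {x0 : ℕ} (hc : 0 ≤ c)
    (hmin : ∀ x, c * v x ≤ p x x0 * u x0) (hηv : c * ∑' x, η x * v x = 0) :
    ∑' y, |∑' x, η x * p x y| * u y ≤ (1 - c) * ∑' x, |η x| * v x := by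
  have hv0 (x : ℕ) : 0 ≤ v x := (hv x).nonneg fun y => mul_nonneg (hp0 _ _) (hu0 _)
  set d : ℕ → ℕ → ℝ := fun x y => p x y * u y - if y = x0 then c * v x else 0 with hd
  have hd0 (x y : ℕ) : 0 ≤ d x y := by
    by_cases hy : y = x0
    · subst hy
      simpa [hd] using hmin x
    · simpa [hd, hy] using mul_nonneg (hp0 x y) (hu0 y)
  have hdp (x y : ℕ) : d x y ≤ p x y := by
    have h1 : (0 : ℝ) ≤ if y = x0 then c * v x else 0 := by
      split_ifs
      · exact mul_nonneg hc (hv0 x)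
      · exact le_rfl
    have h2 := mul_le_of_le_one_right (hp0 x y) (hu1 y)
    simp only [hd]
    linarith
  have hG : Summable fun z : ℕ × ℕ => |η z.1| * d z.1 z.2 :=
    Summable.of_nonneg_of_le (fun z => mul_nonneg (abs_nonneg _) (hd0 _ _))
      (fun z => mul_le_mul_of_nonneg_left (hdp _ _) (abs_nonneg _))
      (summable_abs_mul_kernel hη hp0 hp1)
  have hfib (y : ℕ) : Summable fun x => |η x| * d x y := hG.prod_symm.prod_factor y
  have hηp (y : ℕ) : Summable fun x => η x * p x y :=
    (summable_mul_kernel hη hp0 hp1).prod_symm.prod_factor y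
  have hpt (y : ℕ) : |∑' x, η x * p x y| * u y ≤ ∑' x, |η x| * d x y := by
    have heq : (∑' x, η x * p x y) * u y = ∑' x, η x * d x y := by
      have hsd : Summable fun x => η x * d x y := by
        refine Summable.of_norm ?_
        simpa [abs_mul, abs_of_nonneg (hd0 _ _)] using hfib y
      have hsum := (hηp y).mul_right (u y)
      rw [← tsum_mul_right, ← sub_eq_zero, ← hsum.tsum_sub hsd]
      by_cases hy : y = x0
      · rw [← hηv, ← tsum_mul_left]
        refine tsum_congr fun x => ?_
        simp only [hd, hy, if_true]
        ring
      · simp [hd, hy, mul_assoc]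
    rw [show |∑' x, η x * p x y| * u y = |(∑' x, η x * p x y) * u y| by
      rw [abs_mul, abs_of_nonneg (hu0 y)], heq]
    have := norm_tsum_le_tsum_norm (f := fun x => η x * d x y)
      (by simpa [abs_mul, abs_of_nonneg (hd0 _ _)] using hfib y)
    simpa [abs_mul, abs_of_nonneg (hd0 _ _)] using this
  have hrow (x : ℕ) : ∑' y, |η x| * d x y = (1 - c) * (|η x| * v x) := by
    rw [tsum_mul_left, ((hv x).sub (hasSum_ite_eq x0 (c * v x))).tsum_eq]
    ring
  calc ∑' y, |∑' x, η x * p x y| * u y ≤ ∑' y, ∑' x, |η x| * d x y :=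
        Summable.tsum_le_tsum hpt
          (Summable.of_nonneg_of_le (fun y => mul_nonneg (abs_nonneg _) (hu0 y)) hpt
            hG.prod_symm.prod) hG.prod_symm.prod
    _ = ∑' x, ∑' y, |η x| * d x y := Summable.tsum_comm (f := fun x y => |η x| * d x y) hG
    _ = _ := by simp_rw [hrow, tsum_mul_left]

end WeightedContraction

lemma hasSum_chapman_kolmogorov (x : ℕ) (s t : ℝ≥0) (B : Set ℕ) :
    HasSum (fun y => (M.P x).real {ω | M.X s ω = y} * (M.P y).real {ω | M.X t ω ∈ B})
      ((M.P x).real {ω | M.X (s + t) ω ∈ B}) := by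
  have := M.prob
  have h := chapman_kolmogorov M x s t B
  simp only [measureReal_def]
  rw [h, ENNReal.tsum_toReal_eq fun _ => by finiteness]
  simp_rw [← ENNReal.toReal_mul]
  exact ENNReal.hasSum_toReal (h ▸ measure_ne_top _ _)

lemma hasSum_transition (x : ℕ) (s : ℝ≥0) :
    HasSum (fun y => (M.P x).real {ω | M.X s ω = y}) 1 := by
  have := M.prob
  simpa using hasSum_chapman_kolmogorov M x s 0 univ

lemma abs_signed_flow_le {c : ℝ} {x0 : ℕ} (hc : 0 ≤ c) (hc1 : c ≤ 1)
    (hmin : ∀ (s : ℝ≥0) (x : ℕ), c * (M.P x).real {ω | M.X (1 + s) ω ≠ 0}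
      ≤ (M.P x).real {ω | M.X 1 ω = x0} * (M.P x0).real {ω | M.X s ω ≠ 0})
    (r : ℝ≥0) (n : ℕ) {η : ℕ → ℝ} (hη : Summable fun x => |η x|)
    (hη0 : ∑' x, η x * (M.P x).real {ω | M.X (n + r) ω ≠ 0} = 0) :
    ∑' z, |∑' x, η x * (M.P x).real {ω | M.X (n + r) ω = z}| * (M.P z).real {ω | M.X 0 ω ≠ 0}
      ≤ (1 - c) ^ n * ∑' x, |η x| * (M.P x).real {ω | M.X (n + r) ω ≠ 0} := by
  have := M.prob
  induction n generalizing η with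
  | zero =>
    have h := tsum_abs_tsum_mul_kernel_le (p := fun x y => (M.P x).real {ω | M.X r ω = y})
      (u := fun y => (M.P y).real {ω | M.X 0 ω ≠ 0})
      (v := fun x => (M.P x).real {ω | M.X (r + 0) ω ≠ 0}) (c := 0) (x0 := 0) hη
      (fun _ _ => measureReal_nonneg) (fun x => hasSum_transition M x r)
      (fun _ => measureReal_nonneg) (fun _ => measureReal_le_one)
      (fun x => hasSum_chapman_kolmogorov M x r 0 {0}ᶜ) le_rfl
      (fun x => by simp only [zero_mul]; positivity) (by simp)
    simpa using h
  | succ n ih =>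
    have hp0 : ∀ x y, 0 ≤ (M.P x).real {ω | M.X 1 ω = y} := fun _ _ => measureReal_nonneg
    have hp1 : ∀ x, HasSum (fun y => (M.P x).real {ω | M.X 1 ω = y}) 1 :=
      fun x => hasSum_transition M x 1
    have hu0 : ∀ y, 0 ≤ (M.P y).real {ω | M.X (n + r) ω ≠ 0} := fun _ => measureReal_nonneg
    have hu1 : ∀ y, (M.P y).real {ω | M.X (n + r) ω ≠ 0} ≤ 1 := fun _ => measureReal_le_one
    have hv : ∀ x, HasSum (fun y => (M.P x).real {ω | M.X 1 ω = y}
        * (M.P y).real {ω | M.X (n + r) ω ≠ 0}) ((M.P x).real {ω | M.X (1 + (n + r)) ω ≠ 0}) :=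
      fun x => hasSum_chapman_kolmogorov M x 1 (n + r) {0}ᶜ
    have ht : ((n + 1 : ℕ) : ℝ≥0) + r = 1 + (n + r) := by push_cast; ring
    rw [ht] at hη0 ⊢
    have hflow (z : ℕ) : ∑' y, (∑' x, η x * (M.P x).real {ω | M.X 1 ω = y})
          * (M.P y).real {ω | M.X (n + r) ω = z}
        = ∑' x, η x * (M.P x).real {ω | M.X (1 + (n + r)) ω = z} :=
      tsum_tsum_mul_kernel_mul hη hp0 hp1 (fun _ => measureReal_nonneg)
        (fun _ => measureReal_le_one) fun x => hasSum_chapman_kolmogorov M x 1 (n + r) {z}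
    have h := ih (summable_abs_tsum_mul_kernel hη hp0 hp1)
      ((tsum_tsum_mul_kernel_mul hη hp0 hp1 hu0 hu1 hv).trans hη0)
    simp_rw [hflow] at h
    calc _ ≤ _ := h
      _ ≤ (1 - c) ^ n * ((1 - c) * ∑' x, |η x| * (M.P x).real {ω | M.X (1 + (n + r)) ω ≠ 0}) := by
        refine mul_le_mul_of_nonneg_left ?_ (pow_nonneg (sub_nonneg.2 hc1) n)
        exact tsum_abs_tsum_mul_kernel_le hη hp0 hp1 hu0 hu1 hv hc (hmin (n + r))
          (by rw [hη0, mul_zero])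
      _ = _ := by ring

lemma isProbabilityMeasure_Pmu (μ : Measure ℕ) [IsProbabilityMeasure μ] :
    IsProbabilityMeasure (Pmu M μ) := by
  have := M.prob
  constructor
  rw [Pmu, Measure.bind_apply .univ (measurable_of_countable _).aemeasurable]
  simp

lemma hasSum_Pmu (μ : Measure ℕ) [IsProbabilityMeasure μ] {s : Set Ω} (hs : MeasurableSet s) :
    HasSum (fun x => μ.real {x} * (M.P x).real s) ((Pmu M μ).real s) := by
  have := M.prob
  have := isProbabilityMeasure_Pmu M μ
  have h := Pmu_apply M μ hs
  simp only [measureReal_def]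
  rw [h, ENNReal.tsum_toReal_eq fun _ => by finiteness]
  simp_rw [← ENNReal.toReal_mul, mul_comm (μ _)]
  exact ENNReal.hasSum_toReal (h ▸ measure_ne_top _ _)

lemma measurableSet_survival (t : ℝ≥0) : MeasurableSet {ω | M.X t ω ≠ 0} :=
  M.meas t (MeasurableSet.of_discrete (s := {0}ᶜ))

lemma Pmu_survival_pos (μ : Measure ℕ) [IsProbabilityMeasure μ] (hμ : μ {0} = 0) (t : ℝ≥0) :
    0 < (Pmu M μ).real {ω | M.X t ω ≠ 0} := by
  have := isProbabilityMeasure_Pmu M μ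
  rw [measureReal_def, ENNReal.toReal_pos_iff]
  refine ⟨pos_iff_ne_zero.2 fun h => ?_, measure_lt_top _ _⟩
  rw [Pmu_apply M μ (measurableSet_survival M t), ENNReal.tsum_eq_zero] at h
  refine IsProbabilityMeasure.ne_zero μ (Measure.ext_of_singleton fun x => ?_)
  rcases eq_or_ne x 0 with rfl | hx
  · simpa using hμ
  · simpa [survival_pos M hx t] using h x

lemma condDist_real_singleton (μ : Measure ℕ) (t : ℝ≥0) (z : ℕ) :
    (condDist M μ t {z}).toReal = ((Pmu M μ).real {ω | M.X t ω ≠ 0})⁻¹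
      * ((Pmu M μ).real {ω | M.X t ω = z} * (M.P z).real {ω | M.X 0 ω ≠ 0}) := by
  have hae : alive M t =ᵐ[Pmu M μ] {ω | M.X t ω ≠ 0} :=
    eventuallyEq_set.2 (ae_Pmu M μ fun x => alive_ae_iff M x t)
  have hz : MeasurableSet {ω | M.X t ω = z} := M.meas t (measurableSet_singleton z)
  rw [condDist, Measure.restrict_congr_set hae, measure_congr hae, Measure.smul_apply,
    Measure.map_apply (M.meas t) (measurableSet_singleton z), smul_eq_mul, ENNReal.toReal_mul,
    ENNReal.toReal_inv]
  simp only [measureReal_def]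
  congr 1
  rw [show M.X t ⁻¹' {z} = {ω | M.X t ω = z} from rfl, Measure.restrict_apply hz]
  rcases eq_or_ne z 0 with rfl | hz0
  · rw [survival_zero, show {ω | M.X t ω = 0} ∩ {ω | M.X t ω ≠ 0} = ∅ by ext; simp]
    simp
  · rw [survival_time_zero M hz0, inter_eq_left.2]
    · simp
    · rintro ω rfl
      exact hz0

lemma tvDist_condDist_le {c : ℝ} {x0 : ℕ} (hc : 0 ≤ c) (hc1 : c ≤ 1)
    (hmin : ∀ (s : ℝ≥0) (x : ℕ), c * (M.P x).real {ω | M.X (1 + s) ω ≠ 0}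
      ≤ (M.P x).real {ω | M.X 1 ω = x0} * (M.P x0).real {ω | M.X s ω ≠ 0})
    (μ ν : Measure ℕ) [IsProbabilityMeasure μ] [IsProbabilityMeasure ν] (hμ : μ {0} = 0)
    (hν : ν {0} = 0) (t : ℝ≥0) :
    tvDist (condDist M μ t) (condDist M ν t) ≤ 2 * (1 - c) ^ ⌊(t : ℝ)⌋₊ := by
  have := M.prob
  set n := ⌊(t : ℝ)⌋₊
  obtain ⟨r, hr⟩ : ∃ r : ℝ≥0, (n : ℝ≥0) + r = t := by
    refine ⟨t - n, add_tsub_cancel_of_le ?_⟩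
    exact_mod_cast Nat.floor_le t.2
  have ha := Pmu_survival_pos M μ hμ t
  have hb := Pmu_survival_pos M ν hν t
  have hsa := hasSum_Pmu M μ (measurableSet_survival M t)
  have hsb := hasSum_Pmu M ν (measurableSet_survival M t)
  set a := (Pmu M μ).real {ω | M.X t ω ≠ 0}
  set b := (Pmu M ν).real {ω | M.X t ω ≠ 0}
  have hμ1 : Summable fun x => μ.real {x} := by
    have := hasSum_Pmu M μ MeasurableSet.univ
    simpa using this.summable
  have hν1 : Summable fun x => ν.real {x} := by
    have := hasSum_Pmu M ν MeasurableSet.univ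
    simpa using this.summable
  set η : ℕ → ℝ := fun x => b * μ.real {x} - a * ν.real {x}
  have hη : Summable fun x => |η x| := ((hμ1.mul_left b).sub (hν1.mul_left a)).abs
  have hflow {s : Set Ω} (hs : MeasurableSet s) : ∑' x, η x * (M.P x).real s
      = b * (Pmu M μ).real s - a * (Pmu M ν).real s := by
    rw [← (((hasSum_Pmu M μ hs).mul_left b).sub ((hasSum_Pmu M ν hs).mul_left a)).tsum_eq]
    exact tsum_congr fun x => by simp only [η]; ring
  have hmass : ∑' x, |η x| * (M.P x).real {ω | M.X t ω ≠ 0} ≤ 2 * (a * b) := by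
    have hsum := (hsa.mul_left b).add (hsb.mul_left a)
    have hle (x : ℕ) : |η x| * (M.P x).real {ω | M.X t ω ≠ 0}
        ≤ b * (μ.real {x} * (M.P x).real {ω | M.X t ω ≠ 0})
          + a * (ν.real {x} * (M.P x).real {ω | M.X t ω ≠ 0}) := by
      rw [← mul_assoc, ← mul_assoc, ← add_mul]
      refine mul_le_mul_of_nonneg_right ?_ measureReal_nonneg
      refine (abs_sub _ _).trans_eq ?_
      rw [abs_of_nonneg (by positivity), abs_of_nonneg (by positivity)]
    calc _ ≤ _ := Summable.tsum_le_tsum hle (Summable.of_nonneg_of_le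
            (fun x => mul_nonneg (abs_nonneg _) measureReal_nonneg) hle hsum.summable)
            hsum.summable
      _ = 2 * (a * b) := by rw [hsum.tsum_eq]; ring
  have hcontr := abs_signed_flow_le M hc hc1 hmin r n hη (by
    rw [hr, hflow (measurableSet_survival M t)]
    exact sub_eq_zero.2 (mul_comm b a))
  rw [hr] at hcontr
  have htv : tvDist (condDist M μ t) (condDist M ν t) = (a * b)⁻¹ *
      ∑' z, |∑' x, η x * (M.P x).real {ω | M.X t ω = z}| * (M.P z).real {ω | M.X 0 ω ≠ 0} := by
    rw [tvDist, ← tsum_mul_left]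
    refine tsum_congr fun z => ?_
    have hz : MeasurableSet {ω | M.X t ω = z} := M.meas t (measurableSet_singleton z)
    have hw : 0 ≤ (a * b)⁻¹ * (M.P z).real {ω | M.X 0 ω ≠ 0} := by positivity
    rw [condDist_real_singleton, condDist_real_singleton, hflow hz]
    calc _ = |(b * (Pmu M μ).real {ω | M.X t ω = z} - a * (Pmu M ν).real {ω | M.X t ω = z})
          * ((a * b)⁻¹ * (M.P z).real {ω | M.X 0 ω ≠ 0})| := by
          congr 1
          change a⁻¹ * _ - b⁻¹ * _ = _
          field_simp
      _ = _ := by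
          rw [abs_mul, abs_of_nonneg hw]
          ring
  rw [htv]
  calc _ ≤ (a * b)⁻¹ * ((1 - c) ^ n * (2 * (a * b))) := by
        refine mul_le_mul_of_nonneg_left (hcontr.trans ?_) (by positivity)
        exact mul_le_mul_of_nonneg_left hmass (pow_nonneg (sub_nonneg.2 hc1) n)
    _ = _ := by field_simp

lemma minorization_of_hypH {K : Set ℕ} {x0 : ℕ} {c1 c2 c3 c4 l0 : ℝ}
    (hH : HypH M K x0 c1 c2 c3 c4 l0) (s : ℝ≥0) (x : ℕ) :
    c1 * c2 * c3 / (2 * c4) * (M.P x).real {ω | M.X (1 + s) ω ≠ 0}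
      ≤ (M.P x).real {ω | M.X 1 ω = x0} * (M.P x0).real {ω | M.X s ω ≠ 0} := by
  have := M.prob
  have h := doeblin_minorization M hH s x
  obtain ⟨-, -, hc1, hc2, hc3, hc4, -⟩ := hH
  have h' := ENNReal.toReal_mono (by finiteness) h
  rw [ENNReal.toReal_mul, ENNReal.toReal_mul, ENNReal.toReal_mul,
    ENNReal.toReal_ofReal (by positivity), ENNReal.toReal_ofReal hc4.le] at h'
  simp only [← measureReal_def] at h'
  have h0 : 0 ≤ (M.P x).real {ω | M.X 1 ω = x0} * (M.P x0).real {ω | M.X s ω ≠ 0} := by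
    positivity
  rw [div_mul_eq_mul_div, div_le_iff₀ (by positivity)]
  nlinarith

end AbsorbedProcess

/-- under Hypothesis (H), if `ρ` is the (unique) quasi-stationary
distribution of `X`, then for every probability measure `μ` on `ℕ*` and every
`t ≥ 0`, `‖ℙ_μ(X_t ∈ · | t < T_0) − ρ‖_TV ≤ 2 (1 − c₁c₂c₃/(2c₄))^⌊t⌋`; in
particular `ℙ_μ(X_t ∈ · | t < T_0)` converges in total variation to `ρ` as
`t → ∞`, for every initial distribution `μ`. -/
theorem conv_to_qsd_of_hypH (M : AbsorbedProcess Ω) (K : Set ℕ) (x0 : ℕ)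
    (c1 c2 c3 c4 l0 : ℝ) (hH : HypH M K x0 c1 c2 c3 c4 l0)
    (ρ : Measure ℕ) [IsProbabilityMeasure ρ] (hρ0 : ρ {0} = 0)
    (hQSD : ∀ t : ℝ≥0, condDist M ρ t = ρ)
    (μ : Measure ℕ) [IsProbabilityMeasure μ] (hμ : μ {0} = 0) :
    (∀ t : ℝ≥0, tvDist (condDist M μ t) ρ
        ≤ 2 * (1 - c1 * c2 * c3 / (2 * c4)) ^ ⌊(t : ℝ)⌋₊) ∧
    Filter.Tendsto (fun t : ℝ≥0 => tvDist (condDist M μ t) ρ)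
      Filter.atTop (nhds 0) := by
  have := M.prob
  have hmin := minorization_of_hypH M hH
  obtain ⟨h0K, hx0, hc1, hc2, hc3, hc4, -⟩ := hH
  have hx00 : x0 ≠ 0 := fun h => h0K (h ▸ hx0)
  set c := c1 * c2 * c3 / (2 * c4)
  have hc : 0 < c := by positivity
  have hle1 : c ≤ 1 := by
    have hpos : 0 < (M.P x0).real {ω | M.X (1 + 0) ω ≠ 0} :=
      ENNReal.toReal_pos (survival_pos M hx00 _) (measure_ne_top _ _)
    have hle : (M.P x0).real {ω | M.X 1 ω = x0} * (M.P x0).real {ω | M.X 0 ω ≠ 0}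
        ≤ (M.P x0).real {ω | M.X (1 + 0) ω ≠ 0} := by
      refine (mul_le_of_le_one_right measureReal_nonneg measureReal_le_one).trans ?_
      refine measureReal_mono ?_
      rintro ω rfl
      simpa using hx00
    refine le_of_mul_le_mul_right ?_ hpos
    rw [one_mul]
    exact (hmin 0 x0).trans hle
  have hbound (t : ℝ≥0) : tvDist (condDist M μ t) ρ ≤ 2 * (1 - c) ^ ⌊(t : ℝ)⌋₊ := by
    have h := tvDist_condDist_le M hc.le hle1 hmin μ ρ hμ hρ0 t
    rwa [hQSD t] at h
  refine ⟨hbound, squeeze_zero (fun t => tsum_nonneg fun x => abs_nonneg _) hbound ?_⟩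
  have hpow := tendsto_pow_atTop_nhds_zero_of_lt_one (sub_nonneg.2 hle1) (sub_lt_self 1 hc)
  have hfloor : Tendsto (fun t : ℝ≥0 => ⌊(t : ℝ)⌋₊) atTop atTop :=
    tendsto_nat_floor_atTop.comp (NNReal.tendsto_coe_atTop.2 tendsto_id)
  simpa using (hpow.comp hfloor).const_mul 2

end
end
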